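/- Let n ≥ 17. Every irreducible finite-dimensional continuous real representation of SO_n(ℝ) whose dimension is strictly smaller than (n−1)(n+2)/2 is isomorphic to exactly one of: the trivial one-dimensional representation ℝ, the standard representation ℝⁿ (Q acting by Q·v = Qv), or Alt²(ℝⁿ) with the conjugation action Q·X = QXQᵀ (of dimensions 1, n, and n(n−1)/2 respectively). -/

import Mathlib

open Matrix Topology

/-- `SOn n` is the set of real `n × n` special orthogonal matrices. -/
def SOn (n : ℕ) : Set (Matrix (Fin n) (Fin n) ℝ) :=
  {Q | Qᵀ * Q = 1 ∧ Q.det = 1}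

/-- `Alt²(ℝⁿ)`: the space of real skew-symmetric `n × n` matrices. -/
def altTwo (n : ℕ) : Submodule ℝ (Matrix (Fin n) (Fin n) ℝ) where
  carrier := {X | Xᵀ = -X}
  add_mem' := fun hX hY => by
    simp only [Set.mem_setOf_eq] at *
    rw [Matrix.transpose_add, hX, hY, neg_add]
  zero_mem' := by simp
  smul_mem' := fun c X hX => by
    simp only [Set.mem_setOf_eq] at *
    rw [Matrix.transpose_smul, hX, smul_neg]

/-- The representation `ρ` of `SO_n(ℝ)` on `ℝᵈ` is isomorphic to the trivial one-dimensional
representation `ℝ`. -/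
def IsoTrivial (n d : ℕ) (ρ : Matrix (Fin n) (Fin n) ℝ → Matrix (Fin d) (Fin d) ℝ) : Prop :=
  ∃ e : (Fin d → ℝ) ≃ₗ[ℝ] ℝ, ∀ Q ∈ SOn n, ∀ v : Fin d → ℝ, e ((ρ Q).mulVec v) = e v

/-- The representation `ρ` of `SO_n(ℝ)` on `ℝᵈ` is isomorphic to the standard representation
`ℝⁿ`, with `Q` acting by `v ↦ Q v`. -/
def IsoStandard (n d : ℕ) (ρ : Matrix (Fin n) (Fin n) ℝ → Matrix (Fin d) (Fin d) ℝ) : Prop :=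
  ∃ e : (Fin d → ℝ) ≃ₗ[ℝ] (Fin n → ℝ),
    ∀ Q ∈ SOn n, ∀ v : Fin d → ℝ, e ((ρ Q).mulVec v) = Q.mulVec (e v)

/-- The representation `ρ` of `SO_n(ℝ)` on `ℝᵈ` is isomorphic to `Alt²(ℝⁿ)` with the
conjugation action `Q · X = Q X Qᵀ`. -/
def IsoAlt (n d : ℕ) (ρ : Matrix (Fin n) (Fin n) ℝ → Matrix (Fin d) (Fin d) ℝ) : Prop :=
  ∃ e : (Fin d → ℝ) ≃ₗ[ℝ] altTwo n,
    ∀ Q ∈ SOn n, ∀ v : Fin d → ℝ,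
      (e ((ρ Q).mulVec v) : Matrix (Fin n) (Fin n) ℝ)
        = Q * (e v : Matrix (Fin n) (Fin n) ℝ) * Qᵀ

section BanachAlgebra

open NormedSpace Filter Topology

variable {𝔸 : Type*} [NormedRing 𝔸]

theorem norm_pow_sub_pow_le_mul [NormOneClass 𝔸] {a b : 𝔸} {M : ℝ} (hM : 1 ≤ M) (ha : ‖a‖ ≤ M)
    (hb : ‖b‖ ≤ M) (k : ℕ) : ‖a ^ k - b ^ k‖ ≤ k * M ^ k * ‖a - b‖ := by
  have hM0 : 0 ≤ M := by linarith
  induction k with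
  | zero => simp
  | succ k ih =>
    have hak : ‖a ^ k‖ ≤ M ^ (k + 1) := calc
      ‖a ^ k‖ ≤ ‖a‖ ^ k := norm_pow_le a k
      _ ≤ M ^ k := by gcongr
      _ ≤ M ^ (k + 1) := pow_le_pow_right₀ hM (Nat.le_succ k)
    calc ‖a ^ (k + 1) - b ^ (k + 1)‖ = ‖a ^ k * (a - b) + (a ^ k - b ^ k) * b‖ := by
          congr 1; rw [pow_succ, pow_succ]; noncomm_ring
      _ ≤ ‖a ^ k‖ * ‖a - b‖ + ‖a ^ k - b ^ k‖ * ‖b‖ :=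
          (norm_add_le _ _).trans (add_le_add (norm_mul_le _ _) (norm_mul_le _ _))
      _ ≤ M ^ (k + 1) * ‖a - b‖ + (k * M ^ k * ‖a - b‖) * M := by gcongr
      _ = (k + 1 : ℕ) * M ^ (k + 1) * ‖a - b‖ := by push_cast; ring

variable [NormedAlgebra ℝ 𝔸]

theorem eventually_norm_le_exp_of_hasDerivAt [NormOneClass 𝔸] {g : ℝ → 𝔸} {c : 𝔸} (h0 : g 0 = 1)
    (hg : HasDerivAt g c 0) :
    ∀ᶠ t in 𝓝[>] (0 : ℝ), ‖g t‖ ≤ Real.exp ((‖c‖ + 1) * t) := by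
  have hs : Tendsto (fun t : ℝ => ‖t⁻¹ • (g t - 1)‖) (𝓝[>] 0) (𝓝 ‖c‖) := by
    have := hg.tendsto_slope_zero_right.norm
    simpa only [zero_add, h0] using this
  filter_upwards [hs.eventually_lt_const (lt_add_one ‖c‖), self_mem_nhdsWithin] with t ht ht0
  rw [Set.mem_Ioi] at ht0
  rw [norm_smul, norm_inv, Real.norm_of_nonneg ht0.le, inv_mul_lt_iff₀ ht0] at ht
  calc ‖g t‖ = ‖1 + (g t - 1)‖ := by congr 1; abel
    _ ≤ ‖(1 : 𝔸)‖ + ‖g t - 1‖ := norm_add_le _ _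
    _ ≤ (‖c‖ + 1) * t + 1 := by rw [norm_one]; linarith
    _ ≤ Real.exp ((‖c‖ + 1) * t) := Real.add_one_le_exp _

variable [CompleteSpace 𝔸]

/-- `exp` turns multiples of one element into a one-parameter group. -/
theorem exp_add_smul_self (a : 𝔸) (s t : ℝ) :
    exp ((s + t) • a) = exp (s • a) * exp (t • a) := by
  let _ := NormedAlgebra.restrictScalars ℚ ℝ 𝔸
  rw [add_smul, exp_add_of_commute (((Commute.refl a).smul_left s).smul_right t)]

theorem exp_neg_smul_mul_exp_smul (a : 𝔸) (t : ℝ) : exp ((-t) • a) * exp (t • a) = 1 := by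
  rw [← exp_add_smul_self]; simp

theorem exp_smul_mul_exp_neg_smul (a : 𝔸) (t : ℝ) : exp (t • a) * exp ((-t) • a) = 1 := by
  rw [← exp_add_smul_self]; simp

theorem hasDerivAt_exp_neg_smul (a : 𝔸) (t : ℝ) :
    HasDerivAt (fun u : ℝ => exp ((-u) • a)) (-(exp ((-t) • a) * a)) t := by
  have h := (hasDerivAt_exp_smul_const a (-t)).scomp t (hasDerivAt_neg t)
  rw [neg_one_smul] at h
  exact h

theorem hasDerivAt_exp_smul_zero (a : 𝔸) :
    HasDerivAt (fun u : ℝ => exp (u • a)) a 0 := by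
  simpa using hasDerivAt_exp_smul_const a (0 : ℝ)

/-- A solution of `g' = a g` in a Banach algebra is `exp (t a) g(0)`. -/
theorem eq_exp_smul_mul_of_hasDerivAt {a : 𝔸} {g : ℝ → 𝔸}
    (hg : ∀ t, HasDerivAt g (a * g t) t) (t : ℝ) : g t = exp (t • a) * g 0 := by
  have hconst : ∀ s, HasDerivAt (fun u => exp ((-u) • a) * g u) 0 s := fun s => by
    have := (hasDerivAt_exp_neg_smul a s).mul (hg s)
    rwa [neg_mul, mul_assoc, neg_add_cancel] at this
  have h := is_const_of_deriv_eq_zero (fun s => (hconst s).differentiableAt)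
    (fun s => (hconst s).deriv) t 0
  simp only [neg_zero, zero_smul, exp_zero, one_mul] at h
  rw [← h, ← mul_assoc, exp_smul_mul_exp_neg_smul, one_mul]

/-- An element is determined by the one-parameter group it generates. -/
theorem eq_of_forall_exp_smul_eq {a b : 𝔸} (h : ∀ t : ℝ, exp (t • a) = exp (t • b)) : a = b :=
  (hasDerivAt_exp_smul_zero a).unique
    (by simpa only [h] using hasDerivAt_exp_smul_zero b)

/-- A continuous one-parameter group in a Banach algebra has a generator. -/
theorem exists_generator {f : ℝ → 𝔸} (hf : Continuous f) (h0 : f 0 = 1)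
    (hadd : ∀ s t, f (s + t) = f s * f t) : ∃ a : 𝔸, ∀ t : ℝ, f t = exp (t • a) := by
  set F : ℝ → 𝔸 := fun t => ∫ s in (0 : ℝ)..t, f s with hF
  have hFd : ∀ t, HasDerivAt F (f t) t := fun t =>
    intervalIntegral.integral_hasDerivAt_right (hf.intervalIntegrable _ _)
      hf.aestronglyMeasurable.stronglyMeasurableAtFilter hf.continuousAt
  obtain ⟨h, hh, hu⟩ : ∃ h : ℝ, h ≠ 0 ∧ IsUnit (h⁻¹ • F h) := by
    have hs := (hFd 0).tendsto_slope_zero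
    simp only [zero_add, hF, intervalIntegral.integral_same, sub_zero, h0] at hs
    have hopen : ∀ᶠ x in 𝓝 (1 : 𝔸), IsUnit x := Units.isOpen.mem_nhds isUnit_one
    have hne : ∀ᶠ t : ℝ in 𝓝[≠] 0, t ≠ 0 := eventually_mem_nhdsWithin
    obtain ⟨h, h1, h2⟩ := (hne.and (hs.eventually hopen)).exists
    exact ⟨h, h1, h2⟩
  have hFu : IsUnit (F h) := by
    have h1 : IsUnit (algebraMap ℝ 𝔸 h * (h⁻¹ • F h)) :=
      ((Ne.isUnit hh).map (algebraMap ℝ 𝔸)).mul hu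
    rwa [← Algebra.smul_def, smul_smul, mul_inv_cancel₀ hh, one_smul] at h1
  obtain ⟨u, hu'⟩ := hFu
  have hshift : ∀ t, f t * F h = F (t + h) - F t := fun t => by
    have h1 : f t * F h = ∫ s in (0 : ℝ)..h, f (t + s) := by
      simp only [hF, hadd]
      exact ((ContinuousLinearMap.mul ℝ 𝔸 (f t)).intervalIntegral_comp_comm
        (hf.intervalIntegrable _ _)).symm
    rw [h1, intervalIntegral.integral_comp_add_left, add_zero]
    simp only [hF]
    rw [intervalIntegral.integral_interval_sub_left (hf.intervalIntegrable _ _)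
      (hf.intervalIntegrable _ _)]
  have hfe : f = fun t => (F (t + h) - F t) * (↑u⁻¹ : 𝔸) := by
    funext t
    rw [← hshift, ← hu', mul_assoc, Units.mul_inv, mul_one]
  have hfd0 : HasDerivAt f ((f (0 + h) - f 0) * (↑u⁻¹ : 𝔸)) 0 := by
    conv => arg 1; rw [hfe]
    exact (((hFd (0 + h)).comp_add_const 0 h).sub (hFd 0)).mul_const _
  set a : 𝔸 := (f (0 + h) - f 0) * (↑u⁻¹ : 𝔸)
  refine ⟨a, fun t => ?_⟩
  have hfd : ∀ t, HasDerivAt f (a * f t) t := fun t => by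
    have h1 : HasDerivAt (fun s => f (s - t) * f t) (a * f t) t := by
      have h2 : HasDerivAt (fun s => f (s - t)) a t :=
        HasDerivAt.comp_sub_const t t (by rwa [sub_self])
      exact h2.mul_const _
    convert h1 using 1
    funext s
    rw [← hadd, sub_add_cancel]
  rw [eq_exp_smul_mul_of_hasDerivAt hfd t, h0, mul_one]

/-- If `g(t) = 1 + t c + o(t)` then `g(1/k)^k → exp c`. -/
theorem tendsto_pow_of_hasDerivAt [NormOneClass 𝔸] {g : ℝ → 𝔸} {c : 𝔸} (h0 : g 0 = 1)
    (hg : HasDerivAt g c 0) :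
    Tendsto (fun k : ℕ => g (1 / (k + 1 : ℝ)) ^ (k + 1)) atTop (𝓝 (exp c)) := by
  have hseq : Tendsto (fun k : ℕ => 1 / (k + 1 : ℝ)) atTop (𝓝[>] 0) :=
    tendsto_nhdsWithin_iff.2 ⟨tendsto_one_div_add_atTop_nhds_zero_nat,
      Eventually.of_forall fun k => Set.mem_Ioi.2 Nat.one_div_pos_of_nat⟩
  have he0 : HasDerivAt (fun t : ℝ => exp (t • c)) c 0 := hasDerivAt_exp_smul_zero c
  have hdiff : Tendsto (fun t : ℝ => Real.exp (‖c‖ + 1) * ‖t⁻¹ • (g t - exp (t • c))‖)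
      (𝓝[>] 0) (𝓝 0) := by
    have h1 := (hg.sub he0).tendsto_slope_zero_right.norm
    simpa [h0] using h1.const_mul (Real.exp (‖c‖ + 1))
  rw [tendsto_iff_norm_sub_tendsto_zero]
  refine squeeze_zero' (Eventually.of_forall fun k => norm_nonneg _) ?_ (hdiff.comp hseq)
  filter_upwards [hseq.eventually (eventually_norm_le_exp_of_hasDerivAt h0 hg),
    hseq.eventually (eventually_norm_le_exp_of_hasDerivAt (by simp) he0)] with k hk1 hk2
  have hk : (0 : ℝ) < k + 1 := by positivity
  have hpow : exp ((1 / (k + 1 : ℝ)) • c) ^ (k + 1) = exp c := by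
    let _ := NormedAlgebra.restrictScalars ℚ ℝ 𝔸
    rw [← NormedSpace.exp_nsmul, ← Nat.cast_smul_eq_nsmul ℝ, smul_smul]
    push_cast
    rw [mul_one_div_cancel hk.ne', one_smul]
  rw [← hpow]
  refine (norm_pow_sub_pow_le_mul (Real.one_le_exp (by positivity)) hk1 hk2 (k + 1)).trans_eq ?_
  rw [← Real.exp_nat_mul, Function.comp_apply, norm_smul, norm_inv, norm_div, norm_one,
    Real.norm_of_nonneg hk.le]
  push_cast
  rw [show ((k : ℝ) + 1) * ((‖c‖ + 1) * (1 / (k + 1))) = ‖c‖ + 1 by field_simp]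
  field_simp

/-- The Lie product formula. -/
theorem tendsto_exp_smul_mul_exp_smul_pow [NormOneClass 𝔸] (a b : 𝔸) :
    Tendsto (fun k : ℕ => (exp ((1 / (k + 1 : ℝ)) • a) * exp ((1 / (k + 1 : ℝ)) • b)) ^ (k + 1))
      atTop (𝓝 (exp (a + b))) := by
  have h := (hasDerivAt_exp_smul_zero a).mul (hasDerivAt_exp_smul_zero b)
  refine tendsto_pow_of_hasDerivAt (g := fun t => exp (t • a) * exp (t • b)) (by simp) ?_
  simp only [zero_smul, exp_zero, one_mul, mul_one] at h
  exact h

/-- If `a³ = -a` then `exp (π a) = 1 + 2 a²`. -/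
theorem exp_pi_smul_of_cube_eq_neg {a : 𝔸} (ha : a * (a * a) = -a) :
    exp (Real.pi • a) = 1 + (2 : ℝ) • (a * a) := by
  set g : ℝ → 𝔸 := fun t => 1 + Real.sin t • a + (1 - Real.cos t) • (a * a) with hg
  have hd : ∀ t, HasDerivAt g (a * g t) t := fun t => by
    have h1 : HasDerivAt g (Real.cos t • a + Real.sin t • (a * a)) t := by
      have := (((Real.hasDerivAt_sin t).smul_const a).const_add 1).add
        (((Real.hasDerivAt_cos t).const_sub 1).smul_const (a * a))
      rwa [neg_neg] at this
    convert h1 using 1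
    simp only [hg, mul_add, mul_one, mul_smul_comm, ha, smul_neg, sub_smul, one_smul, mul_sub]
    abel
  have h := eq_exp_smul_mul_of_hasDerivAt hd Real.pi
  simp only [hg, Real.sin_pi, Real.cos_pi, Real.sin_zero, Real.cos_zero, zero_smul, sub_self,
    add_zero, mul_one] at h
  rw [← h]
  norm_num

end BanachAlgebra

section Generation

open Matrix NormedSpace
open scoped Matrix.Norms.Operator

variable {n : ℕ}

theorem SOn_one_mem : (1 : Matrix (Fin n) (Fin n) ℝ) ∈ SOn n :=
  ⟨by simp, by simp⟩

theorem SOn_mul_mem {Q R : Matrix (Fin n) (Fin n) ℝ} (hQ : Q ∈ SOn n) (hR : R ∈ SOn n) :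
    Q * R ∈ SOn n :=
  ⟨by rw [transpose_mul, Matrix.mul_assoc, ← Matrix.mul_assoc Qᵀ, hQ.1, Matrix.one_mul, hR.1],
    by rw [det_mul, hQ.2, hR.2, one_mul]⟩

theorem SOn_mul_transpose {Q : Matrix (Fin n) (Fin n) ℝ} (hQ : Q ∈ SOn n) : Q * Qᵀ = 1 :=
  mul_eq_one_comm.1 hQ.1

theorem SOn_transpose_mem {Q : Matrix (Fin n) (Fin n) ℝ} (hQ : Q ∈ SOn n) : Qᵀ ∈ SOn n :=
  ⟨by rw [transpose_transpose, SOn_mul_transpose hQ], by rw [det_transpose, hQ.2]⟩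

/-- The exponential of a skew-symmetric matrix is a rotation. -/
theorem exp_mem_SOn {X : Matrix (Fin n) (Fin n) ℝ} (hX : Xᵀ = -X) : exp X ∈ SOn n := by
  have horth : ∀ Y : Matrix (Fin n) (Fin n) ℝ, Yᵀ = -Y → (exp Y)ᵀ * exp Y = 1 := fun Y hY => by
    rw [← exp_transpose, hY]
    have h : exp ((-1 : ℝ) • Y) * exp ((1 : ℝ) • Y) = 1 := exp_neg_smul_mul_exp_smul Y 1
    rwa [neg_smul, one_smul] at h
  refine ⟨horth X hX, ?_⟩
  have hsq : exp X = exp ((2 : ℝ)⁻¹ • X) * exp ((2 : ℝ)⁻¹ • X) := by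
    have := exp_add_smul_self X (2 : ℝ)⁻¹ (2 : ℝ)⁻¹
    rwa [← two_mul, mul_inv_cancel₀ two_ne_zero, one_smul] at this
  have h := congrArg det (horth ((2 : ℝ)⁻¹ • X) (by rw [transpose_smul, hX, smul_neg]))
  rwa [det_mul, det_transpose, det_one, ← det_mul, ← hsq] at h

/-- The matrix of the reflection along a unit vector `u`. -/
def unitReflection (u : Fin n → ℝ) : Matrix (Fin n) (Fin n) ℝ := 1 - (2 : ℝ) • vecMulVec u u

theorem unitReflection_mulVec (u v : Fin n → ℝ) :
    unitReflection u *ᵥ v = v - (2 * (u ⬝ᵥ v)) • u := by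
  simp [unitReflection, sub_mulVec, smul_mulVec, vecMulVec_mulVec, mul_smul]

theorem unitReflection_transpose (u : Fin n → ℝ) : (unitReflection u)ᵀ = unitReflection u := by
  simp [unitReflection, transpose_vecMulVec]

theorem unitReflection_mul_self {u : Fin n → ℝ} (hu : u ⬝ᵥ u = 1) :
    unitReflection u * unitReflection u = 1 := by
  simp only [unitReflection, mul_sub, sub_mul, Matrix.one_mul, Matrix.mul_one, smul_mul_assoc,
    mul_smul_comm, vecMulVec_mul_vecMulVec, hu, one_smul]
  module

theorem unitReflection_mul_of_orthogonal {u z : Fin n → ℝ} (hu : u ⬝ᵥ u = 1) (hz : z ⬝ᵥ z = 1)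
    (huz : u ⬝ᵥ z = 0) :
    unitReflection u * unitReflection z
      = exp (Real.pi • (vecMulVec u z - vecMulVec z u)) := by
  have hzu : z ⬝ᵥ u = 0 := by rw [dotProduct_comm, huz]
  have hsq : (vecMulVec u z - vecMulVec z u) * (vecMulVec u z - vecMulVec z u)
      = -(vecMulVec u u + vecMulVec z z) := by
    simp only [mul_sub, sub_mul, vecMulVec_mul_vecMulVec, hu, hz, huz, hzu, one_smul, zero_smul,
      vecMulVec_zero]
    abel
  have hcube : (vecMulVec u z - vecMulVec z u)
      * ((vecMulVec u z - vecMulVec z u) * (vecMulVec u z - vecMulVec z u))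
      = -(vecMulVec u z - vecMulVec z u) := by
    rw [hsq]
    simp only [mul_neg, mul_add, sub_mul, vecMulVec_mul_vecMulVec, hu, hz, huz, hzu, one_smul,
      zero_smul, vecMulVec_zero]
    abel
  refine Eq.trans ?_ (exp_pi_smul_of_cube_eq_neg hcube).symm
  rw [hsq]
  simp only [unitReflection, mul_sub, sub_mul, Matrix.one_mul, Matrix.mul_one, smul_mul_assoc,
    mul_smul_comm, vecMulVec_mul_vecMulVec, huz, zero_smul, vecMulVec_zero, smul_zero]
  module

theorem exists_unit_smul_eq {w : Fin n → ℝ} (hw : w ≠ 0) :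
    ∃ (u : Fin n → ℝ) (c : ℝ), u ⬝ᵥ u = 1 ∧ c ≠ 0 ∧ w = c • u := by
  have hpos : 0 < w ⬝ᵥ w := by
    have h0 : 0 ≤ w ⬝ᵥ w := Finset.sum_nonneg fun i _ => mul_self_nonneg (w i)
    exact lt_of_le_of_ne h0 fun h => hw (dotProduct_self_eq_zero.1 h.symm)
  have hs : Real.sqrt (w ⬝ᵥ w) ≠ 0 := (Real.sqrt_pos.2 hpos).ne'
  refine ⟨(Real.sqrt (w ⬝ᵥ w))⁻¹ • w, Real.sqrt (w ⬝ᵥ w), ?_, hs, ?_⟩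
  · rw [smul_dotProduct, dotProduct_smul, smul_eq_mul, smul_eq_mul, ← mul_assoc, ← mul_inv,
      Real.mul_self_sqrt hpos.le, inv_mul_cancel₀ hpos.ne']
  · rw [smul_smul, mul_inv_cancel₀ hs, one_smul]

theorem exists_unit_orthogonal (hn : 3 ≤ n) (u w : Fin n → ℝ) :
    ∃ z : Fin n → ℝ, z ⬝ᵥ z = 1 ∧ u ⬝ᵥ z = 0 ∧ w ⬝ᵥ z = 0 := by
  have hker : (LinearMap.prod (dotProductBilin ℝ ℝ u) (dotProductBilin ℝ ℝ w)).ker ≠ ⊥ :=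
    LinearMap.ker_ne_bot_of_finrank_lt (by simp; omega)
  obtain ⟨x, hx, hx0⟩ := Submodule.exists_mem_ne_zero_of_ne_bot hker
  obtain ⟨z, c, hz, hc, rfl⟩ := exists_unit_smul_eq hx0
  have hux : u ⬝ᵥ (c • z) = 0 := congrArg Prod.fst hx
  have hwx : w ⬝ᵥ (c • z) = 0 := congrArg Prod.snd hx
  rw [dotProduct_smul, smul_eq_zero] at hux hwx
  exact ⟨z, hz, hux.resolve_left hc, hwx.resolve_left hc⟩

/-- The diagonal matrix which changes the sign of the `i`-th coordinate. -/
def signFlip (i : Fin n) : Matrix (Fin n) (Fin n) ℝ :=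
  diagonal fun k => if k = i then -1 else 1

theorem det_signFlip (i : Fin n) : (signFlip i).det = -1 := by
  simp [signFlip, Finset.prod_ite_eq']

theorem signFlip_eq_unitReflection (i : Fin n) : signFlip i = unitReflection (Pi.single i 1) := by
  ext a b
  by_cases hab : a = b
  · subst hab
    by_cases ha : a = i
    · subst ha; simp [signFlip, unitReflection, vecMulVec_apply]; norm_num
    · simp [signFlip, unitReflection, vecMulVec_apply, ha]
  · simp only [signFlip, unitReflection, vecMulVec_apply, diagonal_apply_ne _ hab,
      Matrix.sub_apply, one_apply_ne hab, Matrix.smul_apply, Pi.single_apply]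
    split_ifs <;> simp_all

/-- Orthogonal matrices are products of reflections: if a property is stable under left
multiplication by reflections and holds at `1`, then it holds for all orthogonal matrices. -/
theorem orthogonal_induction {P : Matrix (Fin n) (Fin n) ℝ → Prop} (h1 : P 1)
    (hrefl : ∀ (u : Fin n → ℝ) (Q), u ⬝ᵥ u = 1 → P Q → P (unitReflection u * Q))
    (Q : Matrix (Fin n) (Fin n) ℝ) (hQ : Qᵀ * Q = 1) : P Q := by
  suffices h : ∀ (m : ℕ) (Q : Matrix (Fin n) (Fin n) ℝ), Qᵀ * Q = 1 →
      (∀ j : Fin n, m ≤ j.val → Q *ᵥ Pi.single j 1 = Pi.single j 1) → P Q from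
    h n Q hQ fun j hj => absurd j.2 (by omega)
  intro m
  induction m with
  | zero =>
    intro Q _ hfix
    have : Q = 1 := by
      ext i j
      have := congrFun (hfix j (Nat.zero_le _)) i
      simpa [one_apply, Pi.single_apply] using this
    rwa [this]
  | succ m ih =>
    intro Q hQ hfix
    have hinner : ∀ x y : Fin n → ℝ, (Q *ᵥ x) ⬝ᵥ (Q *ᵥ y) = x ⬝ᵥ y := fun x y => by
      rw [dotProduct_mulVec, ← mulVec_transpose, mulVec_mulVec, hQ, one_mulVec]
    by_cases hm : m < n
    swap
    · exact ih Q hQ fun j hj => absurd j.2 (by omega)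
    set e : Fin n → ℝ := Pi.single ⟨m, hm⟩ 1 with he
    have hee : e ⬝ᵥ e = 1 := by simp [he]
    by_cases hw : Q *ᵥ e - e = 0
    · refine ih Q hQ fun j hj => ?_
      rcases hj.eq_or_lt with h | h
      · have hj' : j = ⟨m, hm⟩ := Fin.ext h.symm
        rw [hj', ← he]; exact sub_eq_zero.1 hw
      · exact hfix j h
    · obtain ⟨u, c, hu, hc, hwu⟩ := exists_unit_smul_eq hw
      have hQe : Q *ᵥ e = e + c • u := by rw [← hwu]; abel
      have huQ : unitReflection u *ᵥ (Q *ᵥ e) = e := by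
        have h2 : (e + c • u) ⬝ᵥ (e + c • u) = 1 := by rw [← hQe, hinner, hee]
        simp only [add_dotProduct, dotProduct_add, smul_dotProduct, dotProduct_smul, hee, hu,
          smul_eq_mul, dotProduct_comm e u] at h2
        have h3 : 2 * (u ⬝ᵥ e) + c = 0 := by
          have : c * (2 * (u ⬝ᵥ e) + c) = 0 := by linarith
          exact (mul_eq_zero.1 this).resolve_left hc
        rw [hQe, unitReflection_mulVec, dotProduct_add, dotProduct_smul, hu, smul_eq_mul, mul_one,
          show 2 * (u ⬝ᵥ e + c) = c by linarith]
        abel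
      have hdouble : Q = unitReflection u * (unitReflection u * Q) := by
        rw [← Matrix.mul_assoc, unitReflection_mul_self hu, Matrix.one_mul]
      rw [hdouble]
      refine hrefl u _ hu (ih _ ?_ fun j hj => ?_)
      · rw [transpose_mul, unitReflection_transpose, Matrix.mul_assoc, ← hdouble, hQ]
      · rw [← mulVec_mulVec]
        rcases hj.eq_or_lt with h | h
        · have hj' : j = ⟨m, hm⟩ := Fin.ext h.symm
          rw [hj', ← he]; exact huQ
        · rw [hfix j h, unitReflection_mulVec]
          have hje : (Pi.single j 1 : Fin n → ℝ) ⬝ᵥ e = 0 := by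
            have hne : j ≠ ⟨m, hm⟩ := fun h' => by simp [h'] at h
            simp [he, hne]
          have h4 : (Q *ᵥ e - e) ⬝ᵥ Pi.single j 1 = 0 := by
            have h5 := hinner e (Pi.single j 1)
            rw [hfix j h] at h5
            rw [sub_dotProduct, h5, sub_self]
          rw [hwu, smul_dotProduct, smul_eq_mul] at h4
          rw [(mul_eq_zero.1 h4).resolve_left hc]
          simp

/-- `SO_n(ℝ)` is generated by exponentials of skew-symmetric matrices. -/
theorem SOn_induction (hn : 3 ≤ n) {P : Matrix (Fin n) (Fin n) ℝ → Prop}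
    (hmul : ∀ Q ∈ SOn n, ∀ R ∈ SOn n, P Q → P R → P (Q * R))
    (hexp : ∀ X : Matrix (Fin n) (Fin n) ℝ, Xᵀ = -X → P (exp X))
    (Q : Matrix (Fin n) (Fin n) ℝ) (hQ : Q ∈ SOn n) : P Q := by
  have hN : ∀ Q R, (Q ∈ SOn n ∧ P Q) → (R ∈ SOn n ∧ P R) → (Q * R ∈ SOn n ∧ P (Q * R)) :=
    fun Q R hQ hR => ⟨SOn_mul_mem hQ.1 hR.1, hmul Q hQ.1 R hR.1 hQ.2 hR.2⟩
  have horth : ∀ u z : Fin n → ℝ, u ⬝ᵥ u = 1 → z ⬝ᵥ z = 1 → u ⬝ᵥ z = 0 →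
      (unitReflection u * unitReflection z ∈ SOn n ∧ P (unitReflection u * unitReflection z)) := by
    intro u z hu hz huz
    rw [unitReflection_mul_of_orthogonal hu hz huz]
    have hskew : (Real.pi • (vecMulVec u z - vecMulVec z u))ᵀ
        = -(Real.pi • (vecMulVec u z - vecMulVec z u)) := by
      rw [transpose_smul, transpose_sub, transpose_vecMulVec, transpose_vecMulVec, ← smul_neg,
        neg_sub]
    exact ⟨exp_mem_SOn hskew, hexp _ hskew⟩
  have hpair : ∀ u w : Fin n → ℝ, u ⬝ᵥ u = 1 → w ⬝ᵥ w = 1 →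
      (unitReflection u * unitReflection w ∈ SOn n ∧ P (unitReflection u * unitReflection w)) := by
    intro u w hu hw
    obtain ⟨z, hz, huz, hwz⟩ := exists_unit_orthogonal hn u w
    have h := hN _ _ (horth u z hu hz huz) (horth z w hz hw (by rw [dotProduct_comm, hwz]))
    rwa [Matrix.mul_assoc, ← Matrix.mul_assoc (unitReflection z), unitReflection_mul_self hz,
      Matrix.one_mul] at h
  set e : Fin n → ℝ := Pi.single ⟨0, by omega⟩ 1 with he
  have hee : e ⬝ᵥ e = 1 := by simp [he]
  have key := orthogonal_induction
    (P := fun Q => (Q ∈ SOn n ∧ P Q) ∨ (unitReflection e * Q ∈ SOn n ∧ P (unitReflection e * Q)))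
    (Or.inl (by simpa [unitReflection_mul_self hee] using hpair e e hee hee))
    (fun u Q hu hQ => by
      rcases hQ with hQ | hQ
      · right
        rw [← Matrix.mul_assoc]
        exact hN _ _ (hpair e u hee hu) hQ
      · left
        have h := hN _ _ (hpair u e hu hee) hQ
        rwa [Matrix.mul_assoc, ← Matrix.mul_assoc (unitReflection e), unitReflection_mul_self hee,
          Matrix.one_mul] at h) Q hQ.1
  rcases key with h | h
  · exact h.2
  · exfalso
    have hdet := h.1.2
    rw [det_mul, hQ.2, he, ← signFlip_eq_unitReflection, det_signFlip] at hdet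
    norm_num at hdet

end Generation

section Differential

open Matrix NormedSpace Topology
open scoped Matrix.Norms.Operator

/-- `ρ` restricts to a continuous homomorphism on the special orthogonal group. -/
structure IsContinuousRep (n d : ℕ)
    (ρ : Matrix (Fin n) (Fin n) ℝ → Matrix (Fin d) (Fin d) ℝ) : Prop where
  map_one : ρ 1 = 1
  map_mul : ∀ Q ∈ SOn n, ∀ R ∈ SOn n, ρ (Q * R) = ρ Q * ρ R
  continuousOn : ContinuousOn ρ (SOn n)

variable {n d : ℕ} {ρ : Matrix (Fin n) (Fin n) ℝ → Matrix (Fin d) (Fin d) ℝ}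

theorem skew_smul {X : Matrix (Fin n) (Fin n) ℝ} (hX : Xᵀ = -X) (t : ℝ) :
    (t • X)ᵀ = -(t • X) := by
  rw [transpose_smul, hX, smul_neg]

theorem skew_add {X Y : Matrix (Fin n) (Fin n) ℝ} (hX : Xᵀ = -X) (hY : Yᵀ = -Y) :
    (X + Y)ᵀ = -(X + Y) := by
  rw [transpose_add, hX, hY, neg_add]

theorem skew_conj {X : Matrix (Fin n) (Fin n) ℝ} (hX : Xᵀ = -X) (Q : Matrix (Fin n) (Fin n) ℝ) :
    (Q * X * Qᵀ)ᵀ = -(Q * X * Qᵀ) := by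
  rw [transpose_mul, transpose_mul, transpose_transpose, hX, ← Matrix.mul_assoc, Matrix.mul_neg,
    Matrix.neg_mul]

theorem exp_conj_of_mem_SOn {Q : Matrix (Fin n) (Fin n) ℝ} (hQ : Q ∈ SOn n)
    (X : Matrix (Fin n) (Fin n) ℝ) : exp (Q * X * Qᵀ) = Q * exp X * Qᵀ := by
  have hinv : Q⁻¹ = Qᵀ := inv_eq_left_inv hQ.1
  rw [← hinv]
  exact Matrix.exp_conj Q X ⟨⟨Q, Qᵀ, SOn_mul_transpose hQ, hQ.1⟩, rfl⟩

theorem matrix_exp_add_smul_self {m : ℕ} (X : Matrix (Fin m) (Fin m) ℝ) (s t : ℝ) :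
    exp ((s + t) • X) = exp (s • X) * exp (t • X) :=
  exp_add_smul_self X s t

theorem matrix_eq_of_forall_exp_smul_eq {m : ℕ} {X Y : Matrix (Fin m) (Fin m) ℝ}
    (h : ∀ t : ℝ, exp (t • X) = exp (t • Y)) : X = Y :=
  eq_of_forall_exp_smul_eq h

theorem matrix_continuous_exp_smul {m : ℕ} (X : Matrix (Fin m) (Fin m) ℝ) :
    Continuous fun t : ℝ => exp (t • X) :=
  exp_continuous.comp (continuous_id.smul continuous_const)

namespace IsContinuousRep

theorem exists_generator (h : IsContinuousRep n d ρ) {X : Matrix (Fin n) (Fin n) ℝ}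
    (hX : Xᵀ = -X) : ∃ a : Matrix (Fin d) (Fin d) ℝ, ∀ t : ℝ, ρ (exp (t • X)) = exp (t • a) := by
  refine _root_.exists_generator (f := fun t : ℝ => ρ (exp (t • X))) ?_ ?_ ?_
  · exact h.continuousOn.comp_continuous (matrix_continuous_exp_smul X)
      fun t => exp_mem_SOn (skew_smul hX t)
  · simp [h.map_one]
  · intro s t
    rw [matrix_exp_add_smul_self]
    exact h.map_mul _ (exp_mem_SOn (skew_smul hX s)) _ (exp_mem_SOn (skew_smul hX t))

theorem map_pow (h : IsContinuousRep n d ρ) {Q : Matrix (Fin n) (Fin n) ℝ} (hQ : Q ∈ SOn n)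
    (k : ℕ) : Q ^ k ∈ SOn n ∧ ρ (Q ^ k) = ρ Q ^ k := by
  induction k with
  | zero => simpa [h.map_one] using SOn_one_mem
  | succ k ih => exact ⟨by rw [pow_succ]; exact SOn_mul_mem ih.1 hQ, by
      rw [pow_succ, h.map_mul _ ih.1 _ hQ, ih.2, pow_succ]⟩

theorem map_exp_add [NeZero n] [NeZero d] (h : IsContinuousRep n d ρ)
    {X Y : Matrix (Fin n) (Fin n) ℝ} (hX : Xᵀ = -X) (hY : Yᵀ = -Y)
    {a b : Matrix (Fin d) (Fin d) ℝ} (ha : ∀ t : ℝ, ρ (exp (t • X)) = exp (t • a))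
    (hb : ∀ t : ℝ, ρ (exp (t • Y)) = exp (t • b)) : ρ (exp (X + Y)) = exp (a + b) := by
  have hmem : ∀ s : ℝ, exp (s • X) * exp (s • Y) ∈ SOn n := fun s =>
    SOn_mul_mem (exp_mem_SOn (skew_smul hX s)) (exp_mem_SOn (skew_smul hY s))
  have hlim : Filter.Tendsto
      (fun k : ℕ => (exp ((1 / (k + 1 : ℝ)) • X) * exp ((1 / (k + 1 : ℝ)) • Y)) ^ (k + 1))
      Filter.atTop (𝓝 (exp (X + Y))) := tendsto_exp_smul_mul_exp_smul_pow X Y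
  have hlim' : Filter.Tendsto
      (fun k : ℕ => (exp ((1 / (k + 1 : ℝ)) • a) * exp ((1 / (k + 1 : ℝ)) • b)) ^ (k + 1))
      Filter.atTop (𝓝 (exp (a + b))) := tendsto_exp_smul_mul_exp_smul_pow a b
  have hcont := (h.continuousOn (exp (X + Y)) (exp_mem_SOn (skew_add hX hY))).tendsto.comp
    (tendsto_nhdsWithin_iff.2 ⟨hlim, Filter.Eventually.of_forall fun k =>
      (h.map_pow (hmem _) (k + 1)).1⟩)
  refine tendsto_nhds_unique (hcont.congr fun k => ?_) hlim'
  rw [Function.comp_apply, (h.map_pow (hmem _) (k + 1)).2,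
    h.map_mul _ (exp_mem_SOn (skew_smul hX _)) _ (exp_mem_SOn (skew_smul hY _)), ha, hb]

/-- The differential of a continuous representation of `SO_n(ℝ)`, extended arbitrarily from
skew-symmetric matrices to all matrices. -/
theorem exists_differential [NeZero n] [NeZero d] (h : IsContinuousRep n d ρ) :
    ∃ Φ : Matrix (Fin n) (Fin n) ℝ →ₗ[ℝ] Matrix (Fin d) (Fin d) ℝ,
      (∀ X, Xᵀ = -X → ρ (exp X) = exp (Φ X)) ∧
      ∀ Q ∈ SOn n, ∀ X, Xᵀ = -X → Φ (Q * X * Qᵀ) = ρ Q * Φ X * ρ Qᵀ := by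
  choose φ hφ using fun X : altTwo n => h.exists_generator X.2
  have huniq : ∀ (X : altTwo n) (a : Matrix (Fin d) (Fin d) ℝ),
      (∀ t : ℝ, ρ (exp (t • (X : Matrix (Fin n) (Fin n) ℝ))) = exp (t • a)) → φ X = a :=
    fun X a ha => matrix_eq_of_forall_exp_smul_eq fun t => by rw [← hφ, ha]
  have hscale : ∀ (X : altTwo n) (s t : ℝ),
      ρ (exp (t • s • (X : Matrix (Fin n) (Fin n) ℝ))) = exp (t • s • φ X) := fun X s t => by
    rw [smul_smul, hφ, smul_smul]
  obtain ⟨Φ, hΦ⟩ := LinearMap.exists_extend (p := altTwo n)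
    ({ toFun := φ
       map_add' := fun X Y => huniq _ _ fun t => by
         rw [smul_add, ← h.map_exp_add (skew_smul X.2 t) (skew_smul Y.2 t)
           (fun s => hscale X t s) (fun s => hscale Y t s), Submodule.coe_add, smul_add]
       map_smul' := fun s X => huniq _ _ fun t => hscale X s t } :
      altTwo n →ₗ[ℝ] Matrix (Fin d) (Fin d) ℝ)
  have hval : ∀ X : altTwo n, Φ X = φ X := fun X => LinearMap.congr_fun hΦ X
  refine ⟨Φ, fun X hX => ?_, fun Q hQ X hX => ?_⟩
  · have h1 := hφ ⟨X, hX⟩ 1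
    rw [one_smul, one_smul, ← hval] at h1
    exact h1
  · have hconj := hval ⟨Q * X * Qᵀ, skew_conj hX Q⟩
    have hX' := hval ⟨X, hX⟩
    simp only at hconj hX'
    rw [hconj, hX']
    refine huniq _ _ fun t => ?_
    have hQt := SOn_transpose_mem hQ
    have hexp := exp_mem_SOn (skew_smul hX t)
    have h1 : ρ Q * ρ Qᵀ = 1 := by rw [← h.map_mul Q hQ _ hQt, SOn_mul_transpose hQ, h.map_one]
    have hinv : (ρ Q)⁻¹ = ρ Qᵀ := inv_eq_right_inv h1
    have h2 : t • (Q * X * Qᵀ) = Q * (t • X) * Qᵀ := by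
      rw [Matrix.mul_smul, Matrix.smul_mul]
    have h3 : t • (ρ Q * φ ⟨X, hX⟩ * ρ Qᵀ) = ρ Q * (t • φ ⟨X, hX⟩) * (ρ Q)⁻¹ := by
      rw [hinv, Matrix.mul_smul, Matrix.smul_mul]
    simp only
    rw [h2, h3, exp_conj_of_mem_SOn hQ, Matrix.exp_conj _ _ (isUnit_iff_exists_inv.2 ⟨_, h1⟩),
      h.map_mul _ (SOn_mul_mem hQ hexp) _ hQt, h.map_mul _ hQ _ hexp, hinv, ← hφ ⟨X, hX⟩]

end IsContinuousRep

end Differential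

section Conjugation

open NormedSpace

variable {𝔸 : Type*} [NormedRing 𝔸] [NormedAlgebra ℝ 𝔸] [CompleteSpace 𝔸]

theorem hasDerivAt_exp_smul_conj (a b : 𝔸) (t : ℝ) :
    HasDerivAt (fun u : ℝ => exp (u • a) * b * exp ((-u) • a))
      (a * (exp (t • a) * b * exp ((-t) • a)) - exp (t • a) * b * exp ((-t) • a) * a) t := by
  have h := ((hasDerivAt_exp_smul_const' a t).mul_const b).mul (hasDerivAt_exp_neg_smul a t)
  exact h.congr_deriv (by simp only [mul_assoc, mul_neg, sub_eq_add_neg])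

theorem exp_mem_of_pow_mem [FiniteDimensional ℝ 𝔸] (S : Submodule ℝ 𝔸) {a : 𝔸}
    (h : ∀ k : ℕ, a ^ k ∈ S) : exp a ∈ S := by
  have hclosed : IsClosed (S : Set 𝔸) := S.closed_of_finiteDimensional
  exact hclosed.mem_of_tendsto (exp_series_hasSum_exp' (𝕂 := ℝ) a)
    (Filter.Eventually.of_forall fun s => S.sum_mem fun k _ => S.smul_mem _ (h k))

end Conjugation

section Infinitesimal

open Matrix NormedSpace Topology
open scoped Matrix.Norms.Operator

variable {n d : ℕ} {ρ : Matrix (Fin n) (Fin n) ℝ → Matrix (Fin d) (Fin d) ℝ}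

theorem exp_mulVec_mem {a : Matrix (Fin d) (Fin d) ℝ} {U : Submodule ℝ (Fin d → ℝ)}
    (h : ∀ v ∈ U, a *ᵥ v ∈ U) {v : Fin d → ℝ} (hv : v ∈ U) : exp a *ᵥ v ∈ U := by
  refine exp_mem_of_pow_mem (U.comap ((Matrix.mulVecBilin ℝ ℝ).flip v)) (a := a) fun k => ?_
  change a ^ k *ᵥ v ∈ U
  induction k with
  | zero => simpa using hv
  | succ k ih => rw [pow_succ', ← mulVec_mulVec]; exact h _ ih

theorem mulVec_eq_of_hasDerivAt [NeZero d] {a : Matrix (Fin d) (Fin d) ℝ} {g : ℝ → Fin d → ℝ}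
    (hg : ∀ t, HasDerivAt g (a *ᵥ g t) t) (t : ℝ) : g t = exp (t • a) *ᵥ g 0 := by
  let L : (Fin d → ℝ) →ₗ[ℝ] Matrix (Fin d) (Fin d) ℝ :=
    { toFun := fun v => vecMulVec v 1
      map_add' := fun v w => add_vecMulVec v w 1
      map_smul' := fun c v => smul_vecMulVec c v 1 }
  have hL : ∀ (b : Matrix (Fin d) (Fin d) ℝ) v, L (b *ᵥ v) = b * L v := fun b v =>
    (mul_vecMulVec b v 1).symm
  have hd : ∀ t, HasDerivAt (fun u => L (g u)) (a * L (g t)) t := fun t => by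
    rw [← hL]
    exact L.toContinuousLinearMap.hasFDerivAt.comp_hasDerivAt t (hg t)
  have h : L (g t) = exp (t • a) * L (g 0) := eq_exp_smul_mul_of_hasDerivAt hd t
  rw [← hL] at h
  ext i
  simpa [L, vecMulVec_apply] using congrFun (congrFun h i) 0

/-- `Φ` is the differential of `ρ` (its values off skew-symmetric matrices are irrelevant). -/
structure IsDifferential (ρ : Matrix (Fin n) (Fin n) ℝ → Matrix (Fin d) (Fin d) ℝ)
    (Φ : Matrix (Fin n) (Fin n) ℝ →ₗ[ℝ] Matrix (Fin d) (Fin d) ℝ) : Prop where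
  map_exp : ∀ X, Xᵀ = -X → ρ (exp X) = exp (Φ X)
  map_conj : ∀ Q ∈ SOn n, ∀ X, Xᵀ = -X → Φ (Q * X * Qᵀ) = ρ Q * Φ X * ρ Qᵀ

namespace IsDifferential

variable {Φ : Matrix (Fin n) (Fin n) ℝ →ₗ[ℝ] Matrix (Fin d) (Fin d) ℝ}

theorem map_lie (h : IsDifferential ρ Φ) {X Y : Matrix (Fin n) (Fin n) ℝ}
    (hX : Xᵀ = -X) (hY : Yᵀ = -Y) : Φ (X * Y - Y * X) = Φ X * Φ Y - Φ Y * Φ X := by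
  have hconj : ∀ t : ℝ, Φ (exp (t • X) * Y * exp ((-t) • X))
      = exp (t • Φ X) * Φ Y * exp ((-t) • Φ X) := fun t => by
    have htr : (exp (t • X))ᵀ = exp ((-t) • X) := by
      rw [← exp_transpose, skew_smul hX, neg_smul]
    have h1 := h.map_conj _ (exp_mem_SOn (skew_smul hX t)) Y hY
    rw [htr, h.map_exp _ (skew_smul hX t), h.map_exp _ (skew_smul hX (-t)), map_smul,
      map_smul] at h1
    exact h1
  have hl : HasDerivAt (fun t : ℝ => Φ (exp (t • X) * Y * exp ((-t) • X)))
      (Φ (X * (exp ((0 : ℝ) • X) * Y * exp ((-0 : ℝ) • X))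
        - exp ((0 : ℝ) • X) * Y * exp ((-0 : ℝ) • X) * X)) 0 :=
    Φ.toContinuousLinearMap.hasFDerivAt.comp_hasDerivAt 0 (hasDerivAt_exp_smul_conj X Y 0)
  have hr : HasDerivAt (fun t : ℝ => exp (t • Φ X) * Φ Y * exp ((-t) • Φ X))
      (Φ X * (exp ((0 : ℝ) • Φ X) * Φ Y * exp ((-0 : ℝ) • Φ X))
        - exp ((0 : ℝ) • Φ X) * Φ Y * exp ((-0 : ℝ) • Φ X) * Φ X) 0 :=
    hasDerivAt_exp_smul_conj (Φ X) (Φ Y) 0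
  rw [funext hconj] at hl
  simpa using hl.unique hr

theorem mulVec_mem (h : IsDifferential ρ Φ) (hρ : IsContinuousRep n d ρ) (hn : 3 ≤ n)
    {U : Submodule ℝ (Fin d → ℝ)} (hU : ∀ X, Xᵀ = -X → ∀ v ∈ U, Φ X *ᵥ v ∈ U) :
    ∀ Q ∈ SOn n, ∀ v ∈ U, ρ Q *ᵥ v ∈ U := by
  refine SOn_induction hn (fun Q hQ R hR h1 h2 v hv => ?_) fun X hX v hv => ?_
  · rw [hρ.map_mul Q hQ R hR, ← mulVec_mulVec]
    exact h1 _ (h2 _ hv)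
  · rw [h.map_exp X hX]
    exact exp_mulVec_mem (hU X hX) hv

theorem mulVec_eq_self (h : IsDifferential ρ Φ) (hρ : IsContinuousRep n d ρ) (hn : 3 ≤ n)
    [NeZero d] {v : Fin d → ℝ} (hv : ∀ X, Xᵀ = -X → Φ X *ᵥ v = 0) :
    ∀ Q ∈ SOn n, ρ Q *ᵥ v = v := by
  refine SOn_induction hn (fun Q hQ R hR h1 h2 => ?_) fun X hX => ?_
  · rw [hρ.map_mul Q hQ R hR, ← mulVec_mulVec, h2, h1]
  · rw [h.map_exp X hX]
    have h1 := mulVec_eq_of_hasDerivAt (a := Φ X) (g := fun _ => v)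
      (fun t => by rw [hv X hX]; exact hasDerivAt_const t v) 1
    rw [one_smul] at h1
    exact h1.symm

/-- An infinitesimally equivariant map from the standard representation is equivariant. -/
theorem equivariant_standard (h : IsDifferential ρ Φ) (hρ : IsContinuousRep n d ρ) (hn : 3 ≤ n)
    [NeZero d] (T : (Fin n → ℝ) →ₗ[ℝ] (Fin d → ℝ))
    (hT : ∀ X, Xᵀ = -X → ∀ v, T (X *ᵥ v) = Φ X *ᵥ T v) :
    ∀ Q ∈ SOn n, ∀ v, T (Q *ᵥ v) = ρ Q *ᵥ T v := by
  refine SOn_induction hn (fun Q hQ R hR h1 h2 v => ?_) fun X hX v => ?_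
  · rw [hρ.map_mul Q hQ R hR, ← mulVec_mulVec, ← mulVec_mulVec, h1, h2]
  · let L : Matrix (Fin n) (Fin n) ℝ →ₗ[ℝ] (Fin d → ℝ) := T ∘ₗ (Matrix.mulVecBilin ℝ ℝ).flip v
    have h1 := mulVec_eq_of_hasDerivAt (a := Φ X) (g := fun t : ℝ => T (exp (t • X) *ᵥ v))
      (fun t => by
        have h2 : HasDerivAt (fun t : ℝ => L (exp (t • X))) (L (X * exp (t • X))) t :=
          L.toContinuousLinearMap.hasFDerivAt.comp_hasDerivAt t (hasDerivAt_exp_smul_const' X t)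
        have h3 : L (X * exp (t • X)) = Φ X *ᵥ T (exp (t • X) *ᵥ v) := by
          rw [← hT X hX, mulVec_mulVec]; rfl
        rw [h3] at h2
        exact h2) 1
    simpa [h.map_exp X hX] using h1

/-- An infinitesimally equivariant map from the conjugation representation is equivariant on
skew-symmetric matrices. -/
theorem equivariant_conj (h : IsDifferential ρ Φ) (hρ : IsContinuousRep n d ρ) (hn : 3 ≤ n)
    [NeZero d] (T : Matrix (Fin n) (Fin n) ℝ →ₗ[ℝ] (Fin d → ℝ))
    (hT : ∀ X, Xᵀ = -X → ∀ M, Mᵀ = -M → T (X * M - M * X) = Φ X *ᵥ T M) :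
    ∀ Q ∈ SOn n, ∀ M, Mᵀ = -M → T (Q * M * Qᵀ) = ρ Q *ᵥ T M := by
  refine SOn_induction hn (fun Q hQ R hR h1 h2 M hM => ?_) fun X hX M hM => ?_
  · rw [hρ.map_mul Q hQ R hR, ← mulVec_mulVec, ← h2 M hM, ← h1 _ (skew_conj hM R), transpose_mul]
    simp only [Matrix.mul_assoc]
  · have htr : ∀ t : ℝ, (exp (t • X))ᵀ = exp ((-t) • X) := fun t => by
      rw [← exp_transpose, skew_smul hX, neg_smul]
    have h1 := mulVec_eq_of_hasDerivAt (a := Φ X)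
      (g := fun t : ℝ => T (exp (t • X) * M * exp ((-t) • X)))
      (fun t => by
        have h2 : HasDerivAt (fun t : ℝ => T (exp (t • X) * M * exp ((-t) • X)))
            (T (X * (exp (t • X) * M * exp ((-t) • X)) - exp (t • X) * M * exp ((-t) • X) * X)) t :=
          T.toContinuousLinearMap.hasFDerivAt.comp_hasDerivAt t (hasDerivAt_exp_smul_conj X M t)
        rw [hT X hX _ (by rw [← htr]; exact skew_conj hM _)] at h2
        exact h2) 1
    have ht1 := htr 1
    rw [one_smul] at ht1
    simpa [h.map_exp X hX, ht1] using h1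

end IsDifferential

end Infinitesimal

section WeightSpaces

variable {n : ℕ} {V : Type*} [AddCommGroup V] [Module ℝ V]

theorem sum_finrank_le_of_iSupIndep [FiniteDimensional ℝ V] {ι : Type*} [Fintype ι]
    {W : ι → Submodule ℝ V} (h : iSupIndep W) :
    ∑ i, Module.finrank ℝ (W i) ≤ Module.finrank ℝ V := by
  classical
  rw [← Module.finrank_directSum]
  exact LinearMap.finrank_le_finrank_of_injective h.dfinsupp_lsum_injective

/-- The sign vector which is `-1` exactly at `i`. -/
def flipSign (i : Fin n) : Fin n → ℝ := fun a => if a = i then -1 else 1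

@[simp] theorem flipSign_self (i : Fin n) : flipSign i i = -1 := by simp [flipSign]

theorem flipSign_of_ne {i a : Fin n} (h : a ≠ i) : flipSign i a = 1 := by simp [flipSign, h]

@[simp] theorem flipSign_mul_self (i : Fin n) : flipSign i * flipSign i = 1 := by
  ext a; simp only [flipSign, Pi.mul_apply, Pi.one_apply]; split_ifs <;> norm_num

/-- The sign vector which is `-1` exactly on `S`. -/
def setSign (S : Finset (Fin n)) : Fin n → ℝ := fun a => if a ∈ S then -1 else 1

theorem setSign_insert {S : Finset (Fin n)} {i : Fin n} (hi : i ∉ S) :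
    setSign (insert i S) = flipSign i * setSign S := by
  ext a
  by_cases ha : a = i
  · subst ha; simp [setSign, hi]
  · simp [setSign, ha, flipSign]

theorem setSign_empty : setSign (∅ : Finset (Fin n)) = 1 := by
  ext a; simp [setSign]

theorem setSign_singleton (i : Fin n) : setSign {i} = flipSign i := by
  ext a; simp [setSign, flipSign]

theorem setSign_pair {i j : Fin n} (hij : i ≠ j) : setSign {i, j} = flipSign i * flipSign j := by
  rw [setSign_insert (by simpa using hij), setSign_singleton]

/-- A sign vector is determined up to a global sign by the products of its pairs of values. -/
theorem eq_or_eq_compl_of_setSign_mul {S T : Finset (Fin n)}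
    (h : ∀ i j, setSign S i * setSign S j = setSign T i * setSign T j) : S = T ∨ S = Tᶜ := by
  rcases isEmpty_or_nonempty (Fin n) with hE | ⟨⟨a⟩⟩
  · exact Or.inl (Subsingleton.elim _ _)
  by_cases ha : a ∈ S ↔ a ∈ T
  · left; ext i
    have := h a i
    unfold setSign at this
    by_cases h1 : a ∈ S <;> by_cases h2 : i ∈ S <;> by_cases h3 : i ∈ T <;> simp_all <;>
      norm_num at this
  · right; ext i
    have := h a i
    unfold setSign at this
    by_cases h1 : a ∈ S <;> by_cases h2 : i ∈ S <;> by_cases h3 : i ∈ T <;> simp_all <;>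
      norm_num at this

/-- The joint eigenspace on which `δ i j` acts by `s i * s j`. -/
def signSpace (δ : Fin n → Fin n → Module.End ℝ V) (s : Fin n → ℝ) : Submodule ℝ V :=
  ⨅ p : Fin n × Fin n, (δ p.1 p.2).eigenspace (s p.1 * s p.2)

theorem mem_signSpace {δ : Fin n → Fin n → Module.End ℝ V} {s : Fin n → ℝ} {v : V} :
    v ∈ signSpace δ s ↔ ∀ i j, δ i j v = (s i * s j) • v := by
  simp [signSpace, Submodule.mem_iInf]

theorem signSpace_neg (δ : Fin n → Fin n → Module.End ℝ V) (s : Fin n → ℝ) :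
    signSpace δ (-s) = signSpace δ s := by
  simp [signSpace]

theorem signSpace_setSign_compl (δ : Fin n → Fin n → Module.End ℝ V) (S : Finset (Fin n)) :
    signSpace δ (setSign Sᶜ) = signSpace δ (setSign S) := by
  rw [← signSpace_neg]
  congr 1
  ext a
  by_cases h : a ∈ S <;> simp [setSign, h]

/-- The operators `A i j` (infinitesimal rotations in the coordinate planes) and `δ i j` (sign
changes in two coordinates) satisfy the relations of an irreducible representation of `SO_n`. -/
structure IsRotationSystem (A δ : Fin n → Fin n → Module.End ℝ V) : Prop where
  swap : ∀ i j, A i j = -A j i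
  lie : ∀ i j k, i ≠ j → j ≠ k → i ≠ k → A i j * A j k - A j k * A i j = A i k
  comm : ∀ i j k l, i ≠ k → i ≠ l → j ≠ k → j ≠ l → A i j * A k l = A k l * A i j
  sign_self : ∀ i, δ i i = 1
  sign_symm : ∀ i j, δ i j = δ j i
  sign_mul : ∀ i j k, δ i j * δ j k = δ i k
  sign_comm : ∀ i j k l, Commute (δ i j) (δ k l)
  sign_rot : ∀ i j k l, δ i j * A k l
    = ((flipSign k * flipSign l) i * (flipSign k * flipSign l) j) • (A k l * δ i j)
  exists_swap : ∀ i j, i ≠ j → ∃ R : V ≃ₗ[ℝ] V,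
    (∀ k l v, R (δ k l v) = δ (Equiv.swap i j k) (Equiv.swap i j l) (R v)) ∧
    ∀ k l v, A k l v = 0 → A (Equiv.swap i j k) (Equiv.swap i j l) (R v) = 0
  irreducible : ∀ U : Submodule ℝ V, (∀ i j, ∀ v ∈ U, A i j v ∈ U) → U = ⊥ ∨ U = ⊤
  sign_fixed : ∀ v, (∀ i j, A i j v = 0) → ∀ i j, δ i j v = v

namespace IsRotationSystem

variable {A δ : Fin n → Fin n → Module.End ℝ V}

theorem rot_mem (h : IsRotationSystem A δ) {s : Fin n → ℝ} {v : V} (hv : v ∈ signSpace δ s)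
    (k l : Fin n) : A k l v ∈ signSpace δ (flipSign k * flipSign l * s) := by
  rw [mem_signSpace] at hv ⊢
  intro i j
  have h1 := LinearMap.congr_fun (h.sign_rot i j k l) v
  simp only [Module.End.mul_apply, LinearMap.smul_apply, hv, map_smul] at h1
  rw [h1, smul_smul]
  congr 1
  simp only [Pi.mul_apply]
  ring

theorem swap_apply (h : IsRotationSystem A δ) (i j : Fin n) (v : V) : A i j v = -A j i v := by
  rw [h.swap]; rfl

theorem rot_self (h : IsRotationSystem A δ) (i : Fin n) (v : V) : A i i v = 0 := by
  have h1 : (2 : ℝ) • A i i v = 0 := by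
    rw [two_smul]
    exact add_eq_zero_iff_eq_neg.2 (h.swap_apply i i v)
  exact (smul_eq_zero.1 h1).resolve_left two_ne_zero

theorem lie_apply (h : IsRotationSystem A δ) {i j k : Fin n} (hij : i ≠ j) (hjk : j ≠ k)
    (hik : i ≠ k) (v : V) : A i j (A j k v) = A i k v + A j k (A i j v) := by
  rw [← h.lie i j k hij hjk hik]
  simp

theorem comm_apply (h : IsRotationSystem A δ) {i j k l : Fin n} (hik : i ≠ k) (hil : i ≠ l)
    (hjk : j ≠ k) (hjl : j ≠ l) (v : V) : A i j (A k l v) = A k l (A i j v) :=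
  LinearMap.congr_fun (h.comm i j k l hik hil hjk hjl) v

theorem iSupIndep_signSpace (h : IsRotationSystem A δ) {ι : Type*} {s : ι → Fin n → ℝ}
    (hs : ∀ x y, (∀ i j, s x i * s x j = s y i * s y j) → x = y) :
    iSupIndep fun x => signSpace δ (s x) := by
  have h1 := Module.End.independent_iInf_maxGenEigenspace_of_forall_mapsTo
    (fun p : Fin n × Fin n => δ p.1 p.2)
    fun p q φ => Module.End.mapsTo_maxGenEigenspace_of_comm (h.sign_comm _ _ _ _) φ
  refine (h1.comp (f := fun (x : ι) (p : Fin n × Fin n) => s x p.1 * s x p.2)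
    fun x y hxy => hs x y fun i j => congrFun hxy (i, j)).mono fun x => ?_
  exact iInf_mono fun p => Module.End.genEigenspace_le_maximal _ _ _

theorem finrank_signSpace_comp_swap_le [FiniteDimensional ℝ V] (h : IsRotationSystem A δ)
    {i j : Fin n} (hij : i ≠ j) (s : Fin n → ℝ) :
    Module.finrank ℝ (signSpace δ s) ≤ Module.finrank ℝ (signSpace δ (s ∘ Equiv.swap i j)) := by
  obtain ⟨R, hR, -⟩ := h.exists_swap i j hij
  have hmaps : ∀ v ∈ signSpace δ s, R v ∈ signSpace δ (s ∘ Equiv.swap i j) := fun v hv => by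
    rw [mem_signSpace] at hv ⊢
    intro k l
    have h1 := hR (Equiv.swap i j k) (Equiv.swap i j l) v
    rw [hv, map_smul, Equiv.swap_apply_self, Equiv.swap_apply_self] at h1
    exact h1.symm
  exact LinearMap.finrank_le_finrank_of_injective
    (f := (R : V →ₗ[ℝ] V).restrict hmaps) fun x y hxy =>
      Subtype.ext (R.injective (congrArg Subtype.val hxy))

theorem finrank_signSpace_comp_perm [FiniteDimensional ℝ V] (h : IsRotationSystem A δ)
    (σ : Equiv.Perm (Fin n)) (s : Fin n → ℝ) :
    Module.finrank ℝ (signSpace δ (s ∘ σ)) = Module.finrank ℝ (signSpace δ s) := by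
  induction σ using Equiv.Perm.swap_induction_on generalizing s with
  | one => rfl
  | swap_mul σ i j hij ih =>
    rw [Equiv.Perm.coe_mul, ← Function.comp_assoc, ih]
    refine le_antisymm ?_ (h.finrank_signSpace_comp_swap_le hij s)
    refine (h.finrank_signSpace_comp_swap_le hij _).trans (le_of_eq ?_)
    have hs : (s ∘ Equiv.swap i j) ∘ Equiv.swap i j = s := by ext a; simp
    rw [hs]

theorem finrank_signSpace_of_card_eq [FiniteDimensional ℝ V] (h : IsRotationSystem A δ)
    {S T : Finset (Fin n)} (hST : S.card = T.card) :
    Module.finrank ℝ (signSpace δ (setSign S)) = Module.finrank ℝ (signSpace δ (setSign T)) := by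
  let e : {x // x ∈ S} ≃ {x // x ∈ T} := Finset.equivOfCardEq hST
  have hperm : setSign T ∘ e.extendSubtype = setSign S := by
    ext a
    by_cases ha : a ∈ S
    · simp [setSign, ha, e.extendSubtype_mem a ha]
    · simp [setSign, ha, e.extendSubtype_not_mem a ha]
  rw [← h.finrank_signSpace_comp_perm e.extendSubtype (setSign T), hperm]

theorem sum_finrank_signSpace_le [FiniteDimensional ℝ V] (h : IsRotationSystem A δ)
    (F : Finset (Finset (Fin n))) (hF : ∀ S ∈ F, ∀ T ∈ F, S ≠ Tᶜ) :
    ∑ S ∈ F, Module.finrank ℝ (signSpace δ (setSign S)) ≤ Module.finrank ℝ V := by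
  rw [← Finset.sum_coe_sort]
  refine sum_finrank_le_of_iSupIndep (h.iSupIndep_signSpace
    (s := fun S : F => setSign (S : Finset (Fin n))) fun S T hST => Subtype.ext ?_)
  exact (eq_or_eq_compl_of_setSign_mul hST).resolve_right (hF S S.2 T T.2)

theorem exists_joint_eigenvector [Nontrivial V] (h : IsRotationSystem A δ) (a : Fin n)
    (F : Finset (Fin n)) :
    ∃ (v : V) (S : Finset (Fin n)), v ≠ 0 ∧ ∀ i ∈ F, δ a i v = setSign S i • v := by
  induction F using Finset.induction_on with
  | empty =>
    obtain ⟨v, hv⟩ := exists_ne (0 : V)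
    exact ⟨v, ∅, hv, by simp⟩
  | insert i F hi ih =>
    obtain ⟨v, S, hv, hS⟩ := ih
    have hsq : δ a i (δ a i v) = v := by
      have h1 : δ a i * δ a i = 1 := by
        nth_rewrite 2 [h.sign_symm]
        rw [h.sign_mul, h.sign_self]
      exact LinearMap.congr_fun h1 v
    have hne : ∀ j ∈ F, j ≠ i := fun j hj hji => hi (hji ▸ hj)
    by_cases hz : δ a i v + v = 0
    · refine ⟨v, insert i S, hv, fun j hj => ?_⟩
      rcases Finset.mem_insert.1 hj with rfl | hj
      · simpa [setSign] using eq_neg_of_add_eq_zero_left hz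
      · simpa [setSign, hne j hj] using hS j hj
    · refine ⟨δ a i v + v, S.erase i, hz, fun j hj => ?_⟩
      rcases Finset.mem_insert.1 hj with rfl | hj
      · simp [setSign, hsq, add_comm]
      · have h1 : δ a j (δ a i v) = δ a i (δ a j v) := LinearMap.congr_fun (h.sign_comm a j a i) v
        have h2 : setSign (S.erase i) j = setSign S j := by simp [setSign, hne j hj]
        rw [map_add, h1, hS j hj, map_smul, ← smul_add, h2]

theorem exists_signSpace_ne_bot [Nontrivial V] [NeZero n] (h : IsRotationSystem A δ) :
    ∃ S : Finset (Fin n), 2 * S.card ≤ n ∧ signSpace δ (setSign S) ≠ ⊥ := by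
  obtain ⟨v, S, hv, hS⟩ := h.exists_joint_eigenvector 0 Finset.univ
  have hmem : v ∈ signSpace δ (setSign S) := mem_signSpace.2 fun i j => by
    rw [← h.sign_mul i 0 j, h.sign_symm i 0, Module.End.mul_apply, hS j (Finset.mem_univ j),
      map_smul, hS i (Finset.mem_univ i), smul_smul, mul_comm]
  have hne : signSpace δ (setSign S) ≠ ⊥ := fun hbot => hv (by simpa [hbot] using hmem)
  by_cases hc : 2 * S.card ≤ n
  · exact ⟨S, hc, hne⟩
  · refine ⟨Sᶜ, ?_, by rwa [signSpace_setSign_compl]⟩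
    rw [Finset.card_compl, Fintype.card_fin]
    omega

end IsRotationSystem

theorem choose_three_le_choose {m k : ℕ} (h3 : 3 ≤ k) (hk : k + 3 ≤ m) :
    m.choose 3 ≤ m.choose k := by
  have hmono : ∀ k, 3 ≤ k → k ≤ m / 2 → m.choose 3 ≤ m.choose k := fun k h3 =>
    Nat.le_induction (fun _ => le_rfl)
      (fun j _ ih hj => (ih (by omega)).trans (Nat.choose_le_succ_of_lt_half_left (by omega))) k h3
  by_cases h : k ≤ m / 2
  · exact hmono k h3 h
  · rw [← Nat.choose_symm (show k ≤ m by omega)]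
    exact hmono (m - k) (by omega) (by omega)

namespace IsRotationSystem

variable {A δ : Fin n → Fin n → Module.End ℝ V}

theorem signSpace_eq_bot [FiniteDimensional ℝ V] (h : IsRotationSystem A δ) (hn : 8 ≤ n)
    (hd : 2 * Module.finrank ℝ V < (n - 1) * (n + 2)) {S : Finset (Fin n)} (h3 : 3 ≤ S.card)
    (h4 : S.card + 4 ≤ n) : signSpace δ (setSign S) = ⊥ := by
  by_contra hne
  have hpos : 1 ≤ Module.finrank ℝ (signSpace δ (setSign S)) :=
    Nat.one_le_iff_ne_zero.2 fun h0 => hne (Submodule.finrank_eq_zero.1 h0)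
  let a : Fin n := ⟨0, by omega⟩
  have h1 := h.sum_finrank_signSpace_le ((Finset.univ.erase a).powersetCard S.card)
    fun S hS T hT hST => by
      have hSa : a ∉ S := fun hmem =>
        Finset.notMem_erase a _ ((Finset.mem_powersetCard.1 hS).1 hmem)
      have hTa : a ∉ T := fun hmem =>
        Finset.notMem_erase a _ ((Finset.mem_powersetCard.1 hT).1 hmem)
      rw [hST, Finset.mem_compl] at hSa
      exact hSa hTa
  rw [Finset.sum_congr rfl fun T hT =>
    h.finrank_signSpace_of_card_eq (Finset.mem_powersetCard.1 hT).2, Finset.sum_const,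
    Finset.card_powersetCard, Finset.card_erase_of_mem (Finset.mem_univ a), Finset.card_univ,
    Fintype.card_fin, smul_eq_mul] at h1
  have h5 : (n - 1).choose 3 ≤ Module.finrank ℝ V :=
    (choose_three_le_choose h3 (by omega)).trans ((Nat.le_mul_of_pos_right _ hpos).trans h1)
  obtain ⟨m, rfl⟩ : ∃ m, n = m + 3 := ⟨n - 3, by omega⟩
  have h6 := Nat.descFactorial_eq_factorial_mul_choose (m + 2) 3
  simp [Nat.descFactorial, Nat.factorial] at h6
  simp only [show m + 3 - 1 = m + 2 by omega] at h5 hd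
  have h7 : 3 * (m + 5) ≤ m * (m + 1) := by nlinarith
  nlinarith [Nat.mul_le_mul_left (m + 2) h7]

theorem finrank_signSpace_pair [FiniteDimensional ℝ V] (h : IsRotationSystem A δ) (hn : 8 ≤ n)
    (hd : 2 * Module.finrank ℝ V < (n - 1) * (n + 2)) {S : Finset (Fin n)} (hS : S.card = 2)
    (hne : signSpace δ (setSign S) ≠ ⊥) :
    Module.finrank ℝ (signSpace δ (setSign S)) = 1 ∧
      Module.finrank ℝ (signSpace δ (1 : Fin n → ℝ)) + 1 < n := by
  have hpos : 1 ≤ Module.finrank ℝ (signSpace δ (setSign S)) :=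
    Nat.one_le_iff_ne_zero.2 fun h0 => hne (Submodule.finrank_eq_zero.1 h0)
  have hempty : (∅ : Finset (Fin n)) ∉ Finset.powersetCard 2 (Finset.univ : Finset (Fin n)) := by
    simp
  have hcard : ∀ T ∈ insert ∅ (Finset.powersetCard 2 (Finset.univ : Finset (Fin n))),
      T.card ≤ 2 := by
    intro T hT
    rcases Finset.mem_insert.1 hT with rfl | hT
    · simp
    · exact (Finset.mem_powersetCard.1 hT).2.le
  have h1 := h.sum_finrank_signSpace_le (insert ∅ (Finset.powersetCard 2 Finset.univ))
    fun S hS T hT hST => by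
      have h2 := hcard S hS
      have h3 := hcard T hT
      rw [hST, Finset.card_compl, Fintype.card_fin] at h2
      omega
  rw [Finset.sum_insert hempty, Finset.sum_congr rfl fun T hT =>
    h.finrank_signSpace_of_card_eq ((Finset.mem_powersetCard.1 hT).2.trans hS.symm),
    Finset.sum_const, Finset.card_powersetCard, Finset.card_univ, Fintype.card_fin, smul_eq_mul,
    setSign_empty] at h1
  obtain ⟨m, rfl⟩ : ∃ m, n = m + 1 := ⟨n - 1, by omega⟩
  have h6 := Nat.descFactorial_eq_factorial_mul_choose (m + 1) 2
  simp [Nat.descFactorial, Nat.factorial] at h6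
  simp only [Nat.add_sub_cancel] at hd
  have hle : Module.finrank ℝ (signSpace δ (setSign S)) < 2 := by
    by_contra hge
    nlinarith [Nat.mul_le_mul_left ((m + 1).choose 2) (not_lt.1 hge)]
  have hone : Module.finrank ℝ (signSpace δ (setSign S)) = 1 := by omega
  rw [hone] at h1
  exact ⟨hone, by nlinarith⟩

end IsRotationSystem

end WeightSpaces

section Blocks

variable {n : ℕ} {V : Type*} [AddCommGroup V] [Module ℝ V]
  {A δ : Fin n → Fin n → Module.End ℝ V}

theorem exists_fin_notMem {F : Finset (Fin n)} (hF : F.card < n) : ∃ l, l ∉ F := by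
  obtain ⟨l, -, hl⟩ := Finset.exists_mem_notMem_of_card_lt_card
    (s := F) (t := (Finset.univ : Finset (Fin n))) (by simpa using hF)
  exact ⟨l, hl⟩

/-- Hypotheses under which the rotations in the coordinates satisfying `p` act on the weight
spaces of `flipSign i * t`, with `p i`, as on copies of the standard representation. -/
structure IsStandardBlock (A δ : Fin n → Fin n → Module.End ℝ V) (p : Fin n → Prop)
    (t : Fin n → ℝ) : Prop where
  exists_third : ∀ i k, ∃ l, p l ∧ l ≠ i ∧ l ≠ k
  vanish : ∀ i k l, p i → p k → p l → i ≠ k → i ≠ l → k ≠ l →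
    signSpace δ (flipSign i * flipSign k * flipSign l * t) = ⊥
  eq_zero : ∀ i, p i → ∀ z ∈ signSpace δ (flipSign i * t),
    (∀ k l, p k → p l → A k l z = 0) → z = 0

namespace IsStandardBlock

variable {p : Fin n → Prop} {t : Fin n → ℝ}

theorem rot_eq_zero (hB : IsStandardBlock A δ p t) (h : IsRotationSystem A δ) {i k l : Fin n}
    (hi : p i) (hk : p k) (hl : p l) (hik : k ≠ i) (hil : l ≠ i) {v : V}
    (hv : v ∈ signSpace δ (flipSign i * t)) : A k l v = 0 := by
  by_cases hkl : k = l
  · rw [hkl, h.rot_self]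
  have h1 := h.rot_mem hv k l
  rw [show flipSign k * flipSign l * (flipSign i * t) = flipSign k * flipSign l * flipSign i * t by
    ring, hB.vanish k l i hk hl hi hkl hik hil] at h1
  exact (Submodule.mem_bot ℝ).1 h1

theorem rot_mem (h : IsRotationSystem A δ) {i : Fin n} (k : Fin n) {v : V}
    (hv : v ∈ signSpace δ (flipSign i * t)) : A k i v ∈ signSpace δ (flipSign k * t) := by
  have h1 := h.rot_mem hv k i
  rwa [show flipSign k * flipSign i * (flipSign i * t) = flipSign k * t by
    linear_combination (flipSign k * t) * flipSign_mul_self i] at h1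

theorem rot_rot (hB : IsStandardBlock A δ p t) (h : IsRotationSystem A δ) {i k l : Fin n}
    (hi : p i) (hk : p k) (hl : p l) (hki : k ≠ i) (hli : l ≠ i) (hlk : l ≠ k) {v : V}
    (hv : v ∈ signSpace δ (flipSign i * t)) : A l k (A k i v) = A l i v := by
  rw [h.lie_apply hlk hki hli, hB.rot_eq_zero h hi hl hk hli hki hv, map_zero, add_zero]

theorem rot_rot_self (hB : IsStandardBlock A δ p t) (h : IsRotationSystem A δ) {i k : Fin n}
    (hi : p i) (hk : p k) (hki : k ≠ i) {v : V}
    (hv : v ∈ signSpace δ (flipSign i * t)) : A i k (A k i v) = v := by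
  have hz : v - A i k (A k i v) ∈ signSpace δ (flipSign i * t) :=
    Submodule.sub_mem _ hv (rot_mem h i (rot_mem h k hv))
  have hthird : ∀ l, p l → l ≠ i → l ≠ k → A l i (v - A i k (A k i v)) = 0 := by
    intro l hl hli hlk
    have h1 : A l i (A k i v) = 0 :=
      hB.rot_eq_zero h hk hl hi hlk (Ne.symm hki) (rot_mem h k hv)
    rw [map_sub, h.lie_apply hli (Ne.symm hki) hlk, hB.rot_rot h hi hk hl hki hli hlk hv, h1,
      map_zero, add_zero, sub_self]
  have hcol : ∀ l, p l → A l i (v - A i k (A k i v)) = 0 := by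
    intro l hl
    by_cases hli : l = i
    · rw [hli, h.rot_self]
    by_cases hlk : l = k
    · subst hlk
      obtain ⟨m, hm, hmi, hml⟩ := hB.exists_third i l
      have h1 := h.lie_apply (Ne.symm hml) hmi hki (v - A i l (A l i v))
      rw [hthird m hm hmi hml, hB.rot_eq_zero h hi hl hm hli hmi hz, map_zero, map_zero,
        add_zero] at h1
      exact h1.symm
    · exact hthird l hl hli hlk
  refine (sub_eq_zero.1 (hB.eq_zero i hi _ hz fun k' l hk' hl => ?_)).symm
  by_cases hl' : l = i
  · rw [hl']; exact hcol k' hk'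
  by_cases hk'' : k' = i
  · rw [hk'', h.swap_apply, hcol l hl, neg_zero]
  exact hB.rot_eq_zero h hi hk' hl hk'' hl' hz

theorem exists_family (hB : IsStandardBlock A δ p t) (h : IsRotationSystem A δ) {b : Fin n}
    (hb : p b) {x : V} (hx : x ∈ signSpace δ (flipSign b * t)) (hx0 : x ≠ 0) :
    ∃ y : Fin n → V, (∀ i, p i → y i ∈ signSpace δ (flipSign i * t)) ∧ (∀ i, p i → y i ≠ 0) ∧
      ∀ i j, p i → p j → i ≠ j → A i j (y j) = y i := by
  have hrot : ∀ i j, p i → p j → i ≠ j →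
      A i j (if j = b then x else A j b x) = if i = b then x else A i b x := by
    intro i j hi hj hij
    by_cases hjb : j = b
    · subst hjb
      rw [if_pos rfl, if_neg hij]
    · rw [if_neg hjb]
      by_cases hib : i = b
      · subst hib
        rw [if_pos rfl, hB.rot_rot_self h hi hj hjb hx]
      · rw [if_neg hib, hB.rot_rot h hb hj hi hjb hib hij hx]
  refine ⟨fun i => if i = b then x else A i b x, fun i hi => ?_, fun i hi h0 => ?_, hrot⟩
  · dsimp only
    split_ifs with hib
    · rwa [hib]
    · exact rot_mem h i hx
  · by_cases hib : i = b
    · exact hx0 (by simpa [hib] using h0)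
    · have h1 := hrot b i hb hi (Ne.symm hib)
      simp only at h0
      rw [h0, map_zero, if_pos rfl] at h1
      exact hx0 h1.symm

end IsStandardBlock

namespace IsRotationSystem

theorem eq_zero_of_forall_rot_eq_zero (h : IsRotationSystem A δ) {s : Fin n → ℝ} {v : V}
    (hv : v ∈ signSpace δ s) {i j : Fin n} (hs : s i * s j = -1) (h0 : ∀ k l, A k l v = 0) :
    v = 0 := by
  have h1 := mem_signSpace.1 hv i j
  rw [h.sign_fixed v h0 i j, hs, neg_one_smul] at h1
  have h2 : (2 : ℝ) • v = 0 := by rw [two_smul]; exact add_eq_zero_iff_eq_neg.2 h1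
  exact (smul_eq_zero.1 h2).resolve_left two_ne_zero

/-- A nonzero weight vector for a single coordinate generates a standard representation. -/
theorem exists_standard_family (h : IsRotationSystem A δ) (hn : 3 ≤ n)
    (hvan : ∀ i k l : Fin n, i ≠ k → i ≠ l → k ≠ l →
      signSpace δ (flipSign i * flipSign k * flipSign l) = ⊥)
    {b : Fin n} (hb : signSpace δ (flipSign b) ≠ ⊥) :
    ∃ y : Fin n → V, (∀ i, y i ≠ 0) ∧ ∀ k l i, k ≠ l →
      A k l (y i) = (if l = i then y k else 0) - (if k = i then y l else 0) := by
  have hthird : ∀ i k : Fin n, ∃ l, l ≠ i ∧ l ≠ k := fun i k => by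
    obtain ⟨l, hl⟩ := exists_fin_notMem (F := {i, k}) (Finset.card_le_two.trans_lt hn)
    exact ⟨l, by simpa using hl⟩
  have hB : IsStandardBlock A δ (fun _ => True) 1 :=
    { exists_third := fun i k => (hthird i k).imp fun l hl => ⟨trivial, hl⟩
      vanish := fun i k l _ _ _ h1 h2 h3 => by rw [mul_one]; exact hvan i k l h1 h2 h3
      eq_zero := fun i _ z hz h0 => by
        obtain ⟨l, hl, -⟩ := hthird i i
        exact h.eq_zero_of_forall_rot_eq_zero hz (i := i) (j := l)
          (by simp [flipSign_of_ne hl]) fun k l => h0 k l trivial trivial }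
  obtain ⟨x, hx, hx0⟩ := Submodule.exists_mem_ne_zero_of_ne_bot hb
  obtain ⟨y, hy, hy0, hrot⟩ := hB.exists_family h trivial (by rwa [mul_one]) hx0
  refine ⟨y, fun i => hy0 i trivial, fun k l i hkl => ?_⟩
  by_cases hl : l = i
  · subst hl
    rw [if_pos rfl, if_neg hkl, sub_zero, hrot k l trivial trivial hkl]
  by_cases hk : k = i
  · subst hk
    rw [if_neg hl, if_pos rfl, zero_sub, h.swap_apply, hrot l k trivial trivial hl]
  rw [if_neg hl, if_neg hk, sub_zero,
    hB.rot_eq_zero h trivial trivial trivial hk hl (hy i trivial)]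

end IsRotationSystem

end Blocks

section TensorBlocks

variable {n : ℕ} {V : Type*} [AddCommGroup V] [Module ℝ V]
  {A δ : Fin n → Fin n → Module.End ℝ V}

/-- The weight spaces of four coordinates vanish, those of two coordinates are at most lines. -/
structure HasPairLines (δ : Fin n → Fin n → Module.End ℝ V) : Prop where
  vanish : ∀ i j k l, i ≠ j → i ≠ k → i ≠ l → j ≠ k → j ≠ l → k ≠ l →
    signSpace δ (flipSign i * flipSign j * flipSign k * flipSign l) = ⊥
  line : ∀ i j, i ≠ j → ∀ v ∈ signSpace δ (flipSign i * flipSign j),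
    ∀ w ∈ signSpace δ (flipSign i * flipSign j), v ≠ 0 → ∃ c : ℝ, w = c • v

namespace HasPairLines

theorem eq_zero (hL : HasPairLines δ) (h : IsRotationSystem A δ) (hn : 6 ≤ n) {a i : Fin n}
    (hi : i ≠ a) {z : V} (hz : z ∈ signSpace δ (flipSign i * flipSign a))
    (h0 : ∀ k l, k ≠ a → l ≠ a → A k l z = 0) : z = 0 := by
  by_contra hz0
  obtain ⟨R, hRδ, hRA⟩ := h.exists_swap i a hi
  have hRz : R z ∈ signSpace δ (flipSign i * flipSign a) := by
    rw [mem_signSpace] at hz ⊢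
    intro k l
    have h1 := hRδ (Equiv.swap i a k) (Equiv.swap i a l) z
    rw [hz, map_smul, Equiv.swap_apply_self, Equiv.swap_apply_self] at h1
    have h2 : ∀ m, (flipSign i * flipSign a) (Equiv.swap i a m)
        = (flipSign i * flipSign a) m := fun m => by
      by_cases hm : m = i
      · subst hm; simp [mul_comm, flipSign_of_ne hi, flipSign_of_ne hi.symm]
      by_cases hm' : m = a
      · subst hm'; simp [mul_comm, flipSign_of_ne hi, flipSign_of_ne hi.symm]
      rw [Equiv.swap_apply_of_ne_of_ne hm hm']
    rw [h2, h2] at h1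
    exact h1.symm
  obtain ⟨c, hc⟩ := hL.line i a hi z hz (R z) hRz hz0
  have hc0 : c ≠ 0 := by
    rintro rfl
    rw [zero_smul] at hc
    exact hz0 (R.map_eq_zero_iff.1 hc)
  have hcol' : ∀ l, l ≠ i → l ≠ a → A l a z = 0 := by
    intro l hli hla
    have h1 := hRA l i z (h0 l i hla hi)
    rw [Equiv.swap_apply_of_ne_of_ne hli hla, Equiv.swap_apply_left, hc, map_smul] at h1
    exact (smul_eq_zero.1 h1).resolve_left hc0
  obtain ⟨m, hm⟩ := exists_fin_notMem (F := {i, a}) (Finset.card_le_two.trans_lt (by omega))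
  simp only [Finset.mem_insert, Finset.mem_singleton, not_or] at hm
  have hcol : ∀ l, A l a z = 0 := by
    intro l
    by_cases hla : l = a
    · rw [hla, h.rot_self]
    by_cases hli : l = i
    · subst hli
      have h1 := h.lie_apply (Ne.symm hm.1) hm.2 hi z
      rw [hcol' m hm.1 hm.2, h0 l m hi hm.2, map_zero, map_zero, add_zero] at h1
      exact h1.symm
    · exact hcol' l hli hla
  refine hz0 (h.eq_zero_of_forall_rot_eq_zero hz (i := i) (j := m) ?_ fun k l => ?_)
  · simp [flipSign_of_ne hi, flipSign_of_ne hm.1, flipSign_of_ne hm.2]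
  · by_cases hl : l = a
    · rw [hl, hcol]
    by_cases hk : k = a
    · rw [hk, h.swap_apply, hcol, neg_zero]
    exact h0 k l hk hl

theorem isStandardBlock (hL : HasPairLines δ) (h : IsRotationSystem A δ) (hn : 6 ≤ n)
    (a : Fin n) : IsStandardBlock A δ (· ≠ a) (flipSign a) where
  exists_third i k := by
    obtain ⟨l, hl⟩ := exists_fin_notMem (F := {a, i, k})
      (Finset.card_le_three.trans_lt (by omega))
    exact ⟨l, by simpa using hl⟩
  vanish i k l hi hk hl hik hil hkl := hL.vanish i k l a hik hil hi hkl hk hl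
  eq_zero _ hi _ hz h0 := hL.eq_zero h hn hi hz h0

/-- A nonzero weight vector for two coordinates generates a family of vectors which transform
like elementary tensors, either symmetric or antisymmetric. -/
theorem exists_tensor_family (hL : HasPairLines δ) (h : IsRotationSystem A δ) (hn : 6 ≤ n)
    {a b : Fin n} (hab : b ≠ a) (hne : signSpace δ (flipSign b * flipSign a) ≠ ⊥) :
    ∃ (ε : ℝ) (x : Fin n → Fin n → V), ε * ε = 1 ∧ (∀ i, x i i = 0) ∧
      (∀ i j, i ≠ j → x i j ∈ signSpace δ (flipSign i * flipSign j)) ∧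
      (∀ i j, i ≠ j → x i j ≠ 0) ∧ (∀ i j, x i j = ε • x j i) ∧
      ∀ i j k, i ≠ j → i ≠ k → j ≠ k → A i j (x j k) = x i k := by
  have hB := hL.isStandardBlock h hn
  obtain ⟨w, hw, hw0⟩ := Submodule.exists_mem_ne_zero_of_ne_bot hne
  obtain ⟨y, hy, hy0, hrot⟩ := (hB a).exists_family h hab hw hw0
  have hy' : ∀ j, j ≠ a → y j ∈ signSpace δ (flipSign a * flipSign j) := fun j hj => by
    rw [mul_comm]; exact hy j hj
  have hback : ∀ i j, i ≠ a → j ≠ a → i ≠ j → A a i (A i a (y j)) = y j := fun i j hi hj hij =>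
    (hB j).rot_rot_self h hj.symm hij hi (hy' j hj)
  have hmove : ∀ k i j, i ≠ a → j ≠ a → k ≠ a → i ≠ j → k ≠ j → k ≠ i →
      A k i (A i a (y j)) = A k a (y j) := fun k i j hi hj hk hij hkj hki =>
    (hB j).rot_rot h hj.symm hij hkj hi hk hki (hy' j hj)
  have hmem : ∀ i j, j ≠ a → A i a (y j) ∈ signSpace δ (flipSign i * flipSign j) :=
    fun i j hj => IsStandardBlock.rot_mem h i (hy' j hj)
  have hp0 : ∀ i j, i ≠ a → j ≠ a → i ≠ j → A i a (y j) ≠ 0 := fun i j hi hj hij h0 => by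
    have h1 := hback i j hi hj hij
    rw [h0, map_zero] at h1
    exact hy0 j hj h1.symm
  obtain ⟨i₀, hi₀⟩ := exists_fin_notMem (F := {a}) (by simp; omega)
  obtain ⟨j₀, hj₀⟩ := exists_fin_notMem (F := {a, i₀}) (Finset.card_le_two.trans_lt (by omega))
  simp only [Finset.mem_insert, Finset.mem_singleton, not_or] at hi₀ hj₀
  obtain ⟨ε, hε⟩ := hL.line i₀ j₀ (Ne.symm hj₀.2) (A j₀ a (y i₀))
    (by rw [mul_comm]; exact hmem j₀ i₀ hi₀) (A i₀ a (y j₀)) (hmem i₀ j₀ hj₀.1)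
    (hp0 j₀ i₀ hj₀.1 hi₀ hj₀.2)
  have hfirst : ∀ i j k, i ≠ a → j ≠ a → k ≠ a → i ≠ j → k ≠ j →
      A i a (y j) = ε • A j a (y i) → A k a (y j) = ε • A j a (y k) := by
    intro i j k hi hj hk hij hkj hE
    by_cases hki : k = i
    · rwa [hki]
    have h1 := congrArg (A k i) hE
    rwa [map_smul, hmove k i j hi hj hk hij hkj hki, h.comm_apply hkj hk hij hi,
      hrot k i hk hi hki] at h1
  have hsecond : ∀ i j l, i ≠ a → j ≠ a → l ≠ a → i ≠ j → l ≠ i →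
      A i a (y j) = ε • A j a (y i) → A i a (y l) = ε • A l a (y i) := by
    intro i j l hi hj hl hij hli hE
    by_cases hlj : l = j
    · rwa [hlj]
    have h1 := congrArg (A l j) hE
    rwa [map_smul, hmove l j i hj hi hl hij.symm hli hlj, h.comm_apply hli hl hij.symm hj,
      hrot l j hl hj hlj] at h1
  have hsymm : ∀ k l, k ≠ a → l ≠ a → k ≠ l → A k a (y l) = ε • A l a (y k) := by
    intro k l hk hl hkl
    obtain ⟨m, hm⟩ := exists_fin_notMem (F := {a, i₀, j₀, k, l})
      (Finset.card_le_five.trans_lt (by omega))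
    simp only [Finset.mem_insert, Finset.mem_singleton, not_or] at hm
    exact hsecond k m l hk hm.1 hl (Ne.symm hm.2.2.2.1) hkl.symm
      (hfirst i₀ m k hi₀ hm.1 hk (Ne.symm hm.2.1) (Ne.symm hm.2.2.2.1)
        (hsecond i₀ j₀ m hi₀ hj₀.1 hm.1 (Ne.symm hj₀.2) hm.2.1 hε))
  have hεε : ε * ε = 1 := by
    have h1 := hsymm i₀ j₀ hi₀ hj₀.1 (Ne.symm hj₀.2)
    rw [hsymm j₀ i₀ hj₀.1 hi₀ hj₀.2, smul_smul] at h1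
    have h2 : (ε * ε - 1) • A i₀ a (y j₀) = 0 := by rw [sub_smul, one_smul, ← h1, sub_self]
    exact sub_eq_zero.1 ((smul_eq_zero.1 h2).resolve_right
      (hp0 i₀ j₀ hi₀ hj₀.1 (Ne.symm hj₀.2)))
  have hε0 : ε ≠ 0 := by rintro rfl; simp at hεε
  refine ⟨ε, fun i j => if i = j then 0 else if i = a then y j else if j = a then ε • y i
    else A i a (y j), hεε, fun i => if_pos rfl, fun i j hij => ?_, fun i j hij => ?_,
    fun i j => ?_, fun i j k hij hik hjk => ?_⟩ <;> dsimp only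
  · rw [if_neg hij]
    split_ifs with hi hj
    · subst hi; exact hy' j hij.symm
    · subst hj; exact Submodule.smul_mem _ _ (hy i hij)
    · exact hmem i j hj
  · rw [if_neg hij]
    split_ifs with hi hj
    · exact hy0 j (hi ▸ hij.symm)
    · exact smul_ne_zero hε0 (hy0 i hi)
    · exact hp0 i j hi hj hij
  · by_cases hij : i = j
    · simp [hij]
    rw [if_neg hij, if_neg (Ne.symm hij)]
    by_cases hi : i = a
    · have hj : j ≠ a := hi ▸ Ne.symm hij
      rw [if_pos hi, if_neg hj, if_pos hi, smul_smul, hεε, one_smul]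
    by_cases hj : j = a
    · rw [if_neg hi, if_pos hj, if_pos hj]
    rw [if_neg hi, if_neg hj, if_neg hj, if_neg hi]
    exact hsymm i j hi hj hij
  · rw [if_neg hjk, if_neg hik]
    by_cases hk : k = a
    · subst hk
      rw [if_neg hjk, if_pos rfl, if_neg hik, if_pos rfl, map_smul, hrot i j hik hjk hij]
    by_cases hj : j = a
    · subst hj
      rw [if_pos rfl, if_neg hij, if_neg hk]
    by_cases hi : i = a
    · subst hi
      rw [if_neg hj, if_neg hk, if_pos rfl, hback j k hj hk hjk]
    rw [if_neg hj, if_neg hk, if_neg hi, if_neg hk, hmove i j k hj hk hi hjk hik hij]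

end HasPairLines

end TensorBlocks

section TensorFamilies

variable {n : ℕ} {V : Type*} [AddCommGroup V] [Module ℝ V]
  {A δ : Fin n → Fin n → Module.End ℝ V}

/-- A family `x i j` on which the rotations act as on the off-diagonal elementary tensors that
are symmetric (`ε = 1`) or antisymmetric (`ε = -1`), up to diagonal terms. -/
structure IsTensorFamily (A : Fin n → Fin n → Module.End ℝ V) (ε : ℝ)
    (x : Fin n → Fin n → V) : Prop where
  sq : ε * ε = 1
  diag : ∀ i, x i i = 0
  ne_zero : ∀ i j, i ≠ j → x i j ≠ 0
  symm : ∀ i j, x i j = ε • x j i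
  rot : ∀ i j k, i ≠ j → i ≠ k → j ≠ k → A i j (x j k) = x i k
  disjoint : ∀ i j k l, i ≠ j → k ≠ i → k ≠ j → l ≠ i → l ≠ j → A k l (x i j) = 0

namespace IsTensorFamily

variable {ε : ℝ} {x : Fin n → Fin n → V}

theorem rot_right (hx : IsTensorFamily A ε x) {i j l : Fin n} (hlj : l ≠ j) (hli : l ≠ i)
    (hij : i ≠ j) : A l j (x i j) = x i l := by
  rw [hx.symm i j, map_smul, hx.rot l j i hlj hli hij.symm, ← hx.symm]

theorem rot_diag (hx : IsTensorFamily A ε x) (h : IsRotationSystem A δ) {i j k : Fin n}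
    (hki : k ≠ i) (hkj : k ≠ j) (hij : i ≠ j) :
    A k i (A i j (x i j)) = (1 + ε) • x k i := by
  rw [h.lie_apply hki hij hkj, hx.rot_right hkj hki hij, hx.rot k i j hki hkj hij,
    hx.rot_right hij hki.symm hkj, hx.symm i k, add_smul, one_smul, add_comm]

theorem diag_symm (hx : IsTensorFamily A ε x) (h : IsRotationSystem A δ) (i j : Fin n) :
    A i j (x i j) = -(ε • A j i (x j i)) := by
  rw [hx.symm i j, map_smul, h.swap_apply, smul_neg]

theorem eps_mul (hx : IsTensorFamily A ε x) : ε * (1 + ε) = 1 + ε := by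
  linear_combination hx.sq

theorem rot_diag_right (hx : IsTensorFamily A ε x) (h : IsRotationSystem A δ) {i j k : Fin n}
    (hki : k ≠ i) (hkj : k ≠ j) (hij : i ≠ j) :
    A k j (A i j (x i j)) = -((1 + ε) • x k j) := by
  rw [hx.diag_symm h, map_neg, map_smul, hx.rot_diag h hkj hki hij.symm, smul_smul, hx.eps_mul]

theorem rot_diag_disjoint (hx : IsTensorFamily A ε x) (h : IsRotationSystem A δ)
    {i j k l : Fin n} (hij : i ≠ j) (hki : k ≠ i) (hkj : k ≠ j) (hli : l ≠ i) (hlj : l ≠ j) :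
    A k l (A i j (x i j)) = 0 := by
  rw [h.comm_apply hki hkj hli hlj, hx.disjoint i j k l hij hki hkj hli hlj, map_zero]

theorem rot_diag_self (hx : IsTensorFamily A ε x) (h : IsRotationSystem A δ) (hn : 3 ≤ n)
    {i j : Fin n} (hij : i ≠ j) : A i j (A i j (x i j)) = -((2 * (1 + ε)) • x i j) := by
  obtain ⟨k, hk⟩ := exists_fin_notMem (F := {i, j}) (Finset.card_le_two.trans_lt (by omega))
  simp only [Finset.mem_insert, Finset.mem_singleton, not_or] at hk
  have h1 := h.lie_apply (Ne.symm hk.1) hk.2 hij (A i j (x i j))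
  rw [hx.rot_diag_right h hk.1 hk.2 hij, h.swap_apply i k (A i j (x i j)),
    hx.rot_diag h hk.1 hk.2 hij, map_neg, map_smul, map_neg, map_smul, h.swap_apply k j,
    hx.rot j k i (Ne.symm hk.2) hij.symm hk.1,
    hx.rot i k j (Ne.symm hk.1) hij hk.2, hx.symm j i, smul_neg, smul_smul, mul_comm _ ε,
    hx.eps_mul, neg_neg] at h1
  rw [eq_sub_of_add_eq h1.symm]
  module

theorem eps_ne_one [FiniteDimensional ℝ V] (hx : IsTensorFamily A ε x)
    (h : IsRotationSystem A δ) (hn : 3 ≤ n)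
    (hmem : ∀ i j, i ≠ j → x i j ∈ signSpace δ (flipSign i * flipSign j))
    (hd : Module.finrank ℝ (signSpace δ (1 : Fin n → ℝ)) + 1 < n) : ε ≠ 1 := by
  rintro rfl
  let o : Fin n := ⟨0, by omega⟩
  have hu : ∀ j, j ≠ o → A o j (x o j) ∈ signSpace δ (1 : Fin n → ℝ) := fun j hj => by
    have h1 := h.rot_mem (hmem o j hj.symm) o j
    have h2 : flipSign o * flipSign j * (flipSign o * flipSign j) = (1 : Fin n → ℝ) := by
      rw [mul_mul_mul_comm, flipSign_mul_self, flipSign_mul_self, one_mul]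
    rwa [h2] at h1
  have hli : LinearIndependent ℝ (fun j : {j // j ≠ o} =>
      (⟨A o j (x o j), hu j j.2⟩ : signSpace δ (1 : Fin n → ℝ))) := by
    rw [Fintype.linearIndependent_iff]
    intro c hc
    have hsum : ∑ j : {j // j ≠ o}, c j • A o j (x o j) = 0 := by
      simpa using congrArg (Submodule.subtype _) hc
    have heq : ∀ j k : {j // j ≠ o}, c j = c k := by
      intro j k
      by_cases hjk : j = k
      · rw [hjk]
      have hjk' : (j : Fin n) ≠ k := fun e => hjk (Subtype.ext e)
      have h1 := congrArg (A j k) hsum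
      rw [map_sum, map_zero, Fintype.sum_eq_add j k hjk] at h1
      · rw [map_smul, map_smul, h.swap_apply, hx.rot_diag_right h k.2 hjk'.symm j.2.symm,
          hx.rot_diag_right h j.2 hjk' k.2.symm, hx.symm k j, one_smul, neg_neg, smul_neg,
          ← sub_eq_add_neg, ← sub_smul] at h1
        exact sub_eq_zero.1 ((smul_eq_zero.1 h1).resolve_right
          (smul_ne_zero (by norm_num) (hx.ne_zero j k hjk')))
      · rintro i ⟨hij, hik⟩
        rw [map_smul, hx.rot_diag_disjoint h i.2.symm j.2 (fun e => hij (Subtype.ext e.symm)) k.2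
          (fun e => hik (Subtype.ext e.symm)), smul_zero]
    intro m
    have h1 := congrArg (A o m) hsum
    rw [map_sum, map_zero] at h1
    have h2 : ∀ j : {j // j ≠ o}, A o m (c j • A o j (x o j))
        = ((-(if j = m then 4 else 2)) * c m) • x o m := by
      intro j
      rw [heq j m, map_smul]
      split_ifs with hjm
      · rw [hjm, hx.rot_diag_self h hn m.2.symm, smul_neg, smul_smul, ← neg_smul]
        congr 1; ring
      · have hjm' : (j : Fin n) ≠ m := fun e => hjm (Subtype.ext e)
        rw [h.swap_apply, hx.rot_diag h m.2 hjm'.symm j.2.symm, hx.symm m o, one_smul,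
          smul_neg, smul_smul, ← neg_smul]
        congr 1; ring
    rw [Finset.sum_congr rfl fun j _ => h2 j, ← Finset.sum_smul, ← Finset.sum_mul] at h1
    have h3 := (smul_eq_zero.1 h1).resolve_right (hx.ne_zero o m m.2.symm)
    refine (mul_eq_zero.1 h3).resolve_left (ne_of_lt ?_)
    refine Finset.sum_neg (fun j _ => ?_) ⟨m, Finset.mem_univ _⟩
    split_ifs <;> norm_num
  have h1 := hli.fintype_card_le_finrank
  rw [Fintype.card_subtype_compl, Fintype.card_fin, Fintype.card_subtype_eq] at h1
  omega

theorem diag_eq_zero (hx : IsTensorFamily A (-1) x) (h : IsRotationSystem A δ) (hn : 3 ≤ n)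
    {i j : Fin n} (hij : i ≠ j) : A i j (x i j) = 0 := by
  have hkill : ∀ k l, A k l (A i j (x i j)) = 0 := by
    have hki : ∀ k, k ≠ j → A k i (A i j (x i j)) = 0 := fun k hkj => by
      by_cases hki : k = i
      · rw [hki, h.rot_self]
      · rw [hx.rot_diag h hki hkj hij, add_neg_cancel, zero_smul]
    have hkj : ∀ k, k ≠ i → A k j (A i j (x i j)) = 0 := fun k hki => by
      by_cases hkj : k = j
      · rw [hkj, h.rot_self]
      · rw [hx.rot_diag_right h hki hkj hij, add_neg_cancel, zero_smul, neg_zero]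
    have hself : A i j (A i j (x i j)) = 0 := by
      rw [hx.rot_diag_self h hn hij, add_neg_cancel, mul_zero, zero_smul, neg_zero]
    intro k l
    by_cases hli : l = i
    · subst hli
      by_cases hk : k = j
      · rw [hk, h.swap_apply, hself, neg_zero]
      · exact hki k hk
    by_cases hlj : l = j
    · subst hlj
      by_cases hk : k = i
      · rw [hk, hself]
      · exact hkj k hk
    by_cases hk : k = i
    · rw [hk, h.swap_apply, hki l hlj, neg_zero]
    by_cases hk' : k = j
    · rw [hk', h.swap_apply, hkj l hli, neg_zero]
    exact hx.rot_diag_disjoint h hij hk hk' hli hlj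
  have hinv := h.irreducible (Submodule.span ℝ {A i j (x i j)}) fun k l v hv => by
    obtain ⟨c, rfl⟩ := Submodule.mem_span_singleton.1 hv
    rw [map_smul, hkill, smul_zero]
    exact Submodule.zero_mem _
  rcases hinv with hU | hU
  · simpa using hU
  · obtain ⟨k, hk⟩ := exists_fin_notMem (F := {i, j}) (Finset.card_le_two.trans_lt (by omega))
    simp only [Finset.mem_insert, Finset.mem_singleton, not_or] at hk
    obtain ⟨c, hc⟩ := Submodule.mem_span_singleton.1
      (show x i j ∈ Submodule.span ℝ {A i j (x i j)} from hU ▸ Submodule.mem_top)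
    have h1 := hx.rot k i j hk.1 hk.2 hij
    rw [← hc, map_smul, hkill, smul_zero] at h1
    exact absurd h1.symm (hx.ne_zero k j hk.2)

theorem rot_apply (hx : IsTensorFamily A (-1) x) (h : IsRotationSystem A δ) (hn : 3 ≤ n)
    (i j : Fin n) {k l : Fin n} (hkl : k ≠ l) :
    A k l (x i j) = (if l = i then x k j else 0) - (if k = i then x l j else 0)
      + (if l = j then x i k else 0) - (if k = j then x i l else 0) := by
  have hs : ∀ i j, x i j = - x j i := fun i j => by rw [hx.symm, neg_one_smul]
  by_cases hij : i = j
  · subst hij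
    rw [hx.diag, map_zero]
    split_ifs with h1 h2 h2
    · exact absurd (h2.trans h1.symm) hkl
    · rw [hs i k]; abel
    · rw [hs i l]; abel
    · abel
  by_cases hli : l = i
  · subst hli
    by_cases hkj : k = j
    · subst hkj
      rw [h.swap_apply, hx.diag_eq_zero h hn hij]
      simp [hx.diag, hkl, hkl.symm]
    · rw [hx.rot k l j hkl hkj hij]
      simp [hkl, hkj, hij]
  by_cases hki : k = i
  · subst hki
    by_cases hlj : l = j
    · subst hlj
      rw [hx.diag_eq_zero h hn hij]
      simp [hx.diag, hkl, hkl.symm]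
    · rw [h.swap_apply, hx.rot l k j hkl.symm hlj hij]
      simp [hkl.symm, hlj, hij]
  by_cases hlj : l = j
  · subst hlj
    rw [hx.rot_right hkl hki hij]
    simp [hki, hli, hkl]
  by_cases hkj : k = j
  · subst hkj
    rw [h.swap_apply, hx.rot_right hkl.symm hli hij]
    simp [hki, hli, hkl.symm]
  rw [hx.disjoint i j k l hij hki hkj hli hlj]
  simp [hki, hli, hkj, hlj]

theorem coeff_eq_zero (hx : IsTensorFamily A (-1) x) (h : IsRotationSystem A δ) (hn : 6 ≤ n)
    {M : Fin n → Fin n → ℝ} (hM : ∀ i j, M i j = - M j i)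
    (hsum : ∑ i, ∑ j, M i j • x i j = 0) (p q : Fin n) : M p q = 0 := by
  by_cases hpq : p = q
  · subst hpq; linarith [hM p p]
  obtain ⟨r, hr⟩ := exists_fin_notMem (F := {p, q}) (Finset.card_le_two.trans_lt (by omega))
  obtain ⟨t, ht⟩ := exists_fin_notMem (F := {p, q, r}) (Finset.card_le_three.trans_lt (by omega))
  obtain ⟨u, hu⟩ := exists_fin_notMem (F := {p, q, r, t}) (Finset.card_le_four.trans_lt (by omega))
  obtain ⟨v, hv⟩ := exists_fin_notMem (F := {p, q, r, t, u})
    (Finset.card_le_five.trans_lt (by omega))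
  simp only [Finset.mem_insert, Finset.mem_singleton, not_or] at hr ht hu hv
  have hs : ∀ i j, x i j = - x j i := fun i j => by rw [hx.symm, neg_one_smul]
  have hrow : ∀ k l, k ≠ l → ∑ j, M l j • x k j - ∑ j, M k j • x l j = 0 := by
    intro k l hkl
    have h1 := congrArg (A k l) hsum
    have hflip : ∀ a b, ∑ i, M i a • x i b = ∑ i, M a i • x b i := fun a b =>
      Finset.sum_congr rfl fun i _ => by rw [hM i a, hs i b, neg_smul_neg]
    have hout : ∀ a b, (∑ i, ∑ j, if a = i then M i j • x b j else 0) = ∑ j, M a j • x b j :=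
      fun a b => by
        rw [Finset.sum_comm]
        simp only [Finset.sum_ite_eq, Finset.mem_univ, if_true]
    simp only [map_sum, map_zero, map_smul, hx.rot_apply h (by omega) _ _ hkl, smul_add, smul_sub,
      smul_ite, smul_zero, Finset.sum_add_distrib, Finset.sum_sub_distrib, Finset.sum_ite_eq,
      Finset.mem_univ, if_true, hflip, hout] at h1
    have h2 : (2 : ℝ) • (∑ j, M l j • x k j - ∑ j, M k j • x l j) = 0 := by
      rw [← h1]; module
    exact (smul_eq_zero.1 h2).resolve_left two_ne_zero
  have hentry : M p q • x r t - M p t • x r q - (M r q • x p t - M r t • x p q) = 0 := by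
    have h1 := congrArg (A t q) (hrow r p hr.1)
    simpa only [map_sub, map_sum, map_zero, map_smul, hx.rot_apply h (by omega) _ _ ht.2.1,
      Ne.symm hr.2, ht.2.2, Ne.symm hpq, ht.1, if_false, sub_zero, zero_add, smul_sub, smul_ite,
      smul_zero, Finset.sum_sub_distrib, Finset.sum_ite_eq, Finset.mem_univ, if_true] using h1
  have h1 := congrArg (A v t) (congrArg (A u r) hentry)
  simp only [map_sub, map_smul, map_zero,
    hx.rot u r t hu.2.2.1 hu.2.2.2 (Ne.symm ht.2.2), hx.rot u r q hu.2.2.1 hu.2.1 hr.2,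
    hx.disjoint p t u r (Ne.symm ht.1) hu.1 hu.2.2.2 hr.1 (Ne.symm ht.2.2),
    hx.disjoint p q u r hpq hu.1 hu.2.1 hr.1 hr.2,
    hx.rot_right hv.2.2.2.1 hv.2.2.2.2 hu.2.2.2,
    hx.disjoint u q v t hu.2.1 hv.2.2.2.2 hv.2.1 (Ne.symm hu.2.2.2) ht.2.1,
    smul_zero, sub_zero] at h1
  exact (smul_eq_zero.1 h1).resolve_right (hx.ne_zero u v (Ne.symm hv.2.2.2.2))

end IsTensorFamily

theorem HasPairLines.exists_isTensorFamily [FiniteDimensional ℝ V] (hL : HasPairLines δ)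
    (h : IsRotationSystem A δ) (hn : 6 ≤ n) {a b : Fin n} (hab : b ≠ a)
    (hne : signSpace δ (flipSign b * flipSign a) ≠ ⊥)
    (hd : Module.finrank ℝ (signSpace δ (1 : Fin n → ℝ)) + 1 < n) :
    ∃ x, IsTensorFamily A (-1) x := by
  obtain ⟨ε, x, hεε, hdiag, hmem, h0, hsymm, hrot⟩ := hL.exists_tensor_family h hn hab hne
  have hx : IsTensorFamily A ε x := ⟨hεε, hdiag, h0, hsymm, hrot,
    fun i j k l hij hki hkj hli hlj =>
      (hL.isStandardBlock h hn j).rot_eq_zero h hij hkj hlj hki hli (hmem i j hij)⟩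
  have h1 := hx.eps_ne_one h (by omega) hmem hd
  have h2 : ε = -1 := (mul_self_eq_one_iff.1 hεε).resolve_left h1
  exact ⟨x, h2 ▸ hx⟩

end TensorFamilies

section Generators

open Matrix

variable {n : ℕ}

/-- The infinitesimal rotation in the plane of the coordinates `k` and `l`. -/
def rotGen (k l : Fin n) : Matrix (Fin n) (Fin n) ℝ := single k l 1 - single l k 1

theorem rotGen_swap (k l : Fin n) : rotGen k l = -rotGen l k := (neg_sub _ _).symm

theorem rotGen_self (k : Fin n) : rotGen k k = 0 := sub_self _

theorem rotGen_skew (k l : Fin n) : (rotGen k l)ᵀ = -rotGen k l := by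
  simp [rotGen]

theorem rotGen_lie {i j k : Fin n} (hij : i ≠ j) (hjk : j ≠ k) (hik : i ≠ k) :
    rotGen i j * rotGen j k - rotGen j k * rotGen i j = rotGen i k := by
  simp [rotGen, mul_sub, sub_mul, single_mul_single_of_ne, hij, hjk, hik, hij.symm, hjk.symm,
    hik.symm]

theorem rotGen_comm {i j k l : Fin n} (hik : i ≠ k) (hil : i ≠ l) (hjk : j ≠ k) (hjl : j ≠ l) :
    rotGen i j * rotGen k l - rotGen k l * rotGen i j = 0 := by
  simp [rotGen, mul_sub, sub_mul, single_mul_single_of_ne, hik, hil, hjk, hjl, hik.symm,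
    hil.symm, hjk.symm, hjl.symm]

theorem rotGen_mulVec_single (k l i : Fin n) :
    rotGen k l *ᵥ (Pi.single i 1 : Fin n → ℝ)
      = (if l = i then Pi.single k 1 else 0) - (if k = i then Pi.single l 1 else 0) := by
  rw [rotGen, sub_mulVec, single_eq_single_vecMulVec_single, single_eq_single_vecMulVec_single,
    vecMulVec_mulVec, vecMulVec_mulVec]
  split_ifs with h1 h2 h2 <;> simp [h1, h2]

theorem rotGen_lie_single (k l i j : Fin n) :
    rotGen k l * single i j (1 : ℝ) - single i j 1 * rotGen k l
      = (if l = i then single k j 1 else 0) - (if k = i then single l j 1 else 0)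
        + (if l = j then single i k 1 else 0) - (if k = j then single i l 1 else 0) := by
  have hmul : ∀ a b c e : Fin n, single a b (1 : ℝ) * single c e 1
      = if b = c then single a e 1 else 0 := fun a b c e => by
    split_ifs with h
    · rw [h, single_mul_single_same, one_mul]
    · exact single_mul_single_of_ne _ _ _ _ h _
  simp only [rotGen, mul_sub, sub_mul, hmul, eq_comm (a := j)]
  abel

theorem skew_induction {P : Matrix (Fin n) (Fin n) ℝ → Prop} (h0 : P 0)
    (hadd : ∀ X Y, P X → P Y → P (X + Y)) (hsmul : ∀ (c : ℝ) X, P X → P (c • X))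
    (hgen : ∀ k l, k ≠ l → P (rotGen k l)) {X : Matrix (Fin n) (Fin n) ℝ} (hX : Xᵀ = -X) : P X := by
  have hsum : X = ∑ k, ∑ l, (X k l / 2) • rotGen k l := by
    have h1 : ∀ k l, (X k l / 2) • rotGen k l
        = (2⁻¹ : ℝ) • (single k l (X k l) - (single k l (X k l))ᵀ) := fun k l => by
      simp [rotGen, smul_sub, smul_single, div_eq_inv_mul]
    simp only [h1, ← Finset.smul_sum, Finset.sum_sub_distrib, ← transpose_sum]
    rw [← matrix_eq_sum_single, hX]
    module
  have hsum_mem : ∀ (s : Finset (Fin n)) (f : Fin n → Matrix (Fin n) (Fin n) ℝ),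
      (∀ k, P (f k)) → P (∑ k ∈ s, f k) := fun s f hf => by
    induction s using Finset.cons_induction with
    | empty => simpa using h0
    | cons a s ha ih => rw [Finset.sum_cons]; exact hadd _ _ (hf a) ih
  rw [hsum]
  refine hsum_mem _ _ fun k => hsum_mem _ _ fun l => hsmul _ _ ?_
  by_cases hkl : k = l
  · rw [hkl, rotGen_self]; exact h0
  · exact hgen k l hkl

variable {Q : Matrix (Fin n) (Fin n) ℝ} {c : Fin n → ℝ} {σ : Fin n → Fin n}

theorem conj_vecMulVec (Q : Matrix (Fin n) (Fin n) ℝ) (u v : Fin n → ℝ) :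
    Q * vecMulVec u v * Qᵀ = vecMulVec (Q *ᵥ u) (Q *ᵥ v) := by
  rw [mul_vecMulVec, vecMulVec_mul, vecMul_transpose]

theorem conj_rotGen (hQ : ∀ k, Q *ᵥ Pi.single k 1 = c k • Pi.single (σ k) 1) (k l : Fin n) :
    Q * rotGen k l * Qᵀ = (c k * c l) • rotGen (σ k) (σ l) := by
  simp only [rotGen, mul_sub, sub_mul, single_eq_single_vecMulVec_single, conj_vecMulVec, hQ,
    vecMulVec_smul, smul_vecMulVec, smul_smul, smul_sub]
  rw [mul_comm (c l)]

theorem conj_signFlip (hQ : ∀ k, Q *ᵥ Pi.single k 1 = c k • Pi.single (σ k) 1)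
    (hc : ∀ k, c k * c k = 1) (hQ' : Q * Qᵀ = 1) (k : Fin n) :
    Q * signFlip k * Qᵀ = signFlip (σ k) := by
  simp only [signFlip_eq_unitReflection, unitReflection, mul_sub, sub_mul, mul_one, hQ',
    mul_smul_comm, smul_mul_assoc, conj_vecMulVec, hQ, vecMulVec_smul, smul_vecMulVec, smul_smul,
    hc, one_smul]

theorem signFlip_mulVec_single (i k : Fin n) :
    signFlip i *ᵥ (Pi.single k 1 : Fin n → ℝ) = flipSign i k • Pi.single k 1 := by
  rw [signFlip, mulVec_single_one]
  ext a
  by_cases ha : a = k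
  · simp [ha, flipSign]
  · simp [ha]

theorem signFlip_transpose (i : Fin n) : (signFlip i)ᵀ = signFlip i := diagonal_transpose _

theorem signFlip_mul_self (i : Fin n) : signFlip i * signFlip i = 1 := by
  rw [signFlip, diagonal_mul_diagonal, ← diagonal_one]
  congr 1
  funext k
  split_ifs <;> norm_num

theorem signFlip_comm (i j : Fin n) : signFlip i * signFlip j = signFlip j * signFlip i := by
  simp only [signFlip, diagonal_mul_diagonal, mul_comm]

theorem signFlip_mul_mem (i j : Fin n) : signFlip i * signFlip j ∈ SOn n := by
  refine ⟨?_, by rw [det_mul, det_signFlip, det_signFlip]; norm_num⟩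
  rw [transpose_mul, signFlip_transpose, signFlip_transpose, mul_assoc, ← mul_assoc (signFlip i),
    signFlip_mul_self, one_mul, signFlip_mul_self]

theorem signFlip_mul_mulVec_single (i j k : Fin n) :
    (signFlip i * signFlip j) *ᵥ (Pi.single k 1 : Fin n → ℝ)
      = (flipSign k i * flipSign k j) • Pi.single k 1 := by
  rw [← mulVec_mulVec, signFlip_mulVec_single, mulVec_smul, signFlip_mulVec_single, smul_smul]
  simp only [flipSign, eq_comm (a := k), mul_comm]

theorem exists_signed_swap {i j : Fin n} (hij : i ≠ j) :
    ∃ Q ∈ SOn n, ∃ c : Fin n → ℝ, (∀ k, c k * c k = 1) ∧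
      ∀ k, Q *ᵥ Pi.single k 1 = c k • Pi.single (Equiv.swap i j k) 1 := by
  refine ⟨(Equiv.swap i j).permMatrix ℝ * signFlip i, ⟨?_, ?_⟩, fun k => flipSign i k,
    fun k => ?_, fun k => ?_⟩
  · rw [transpose_mul, transpose_permMatrix, signFlip_transpose, mul_assoc,
      ← mul_assoc (Equiv.Perm.permMatrix ℝ _), ← permMatrix_mul, mul_inv_cancel, permMatrix_one,
      one_mul, signFlip_mul_self]
  · rw [det_mul, det_permutation, det_signFlip, Equiv.Perm.sign_swap hij]
    norm_num
  · exact congrFun (flipSign_mul_self i) k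
  · rw [← mulVec_mulVec, signFlip_mulVec_single, mulVec_smul, permMatrix_mulVec]
    congr 1
    ext a
    simp only [Function.comp_apply, Pi.single_apply]
    congr 1
    rw [eq_iff_iff, Equiv.swap_apply_eq_iff]

end Generators

section RotationSystem

open Matrix

variable {n d : ℕ} {ρ : Matrix (Fin n) (Fin n) ℝ → Matrix (Fin d) (Fin d) ℝ}
  {Φ : Matrix (Fin n) (Fin n) ℝ →ₗ[ℝ] Matrix (Fin d) (Fin d) ℝ}

theorem IsDifferential.rot_mul (h : IsDifferential ρ Φ) (hρ : IsContinuousRep n d ρ)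
    {Q X : Matrix (Fin n) (Fin n) ℝ} (hQ : Q ∈ SOn n) (hX : Xᵀ = -X) :
    ρ Q * Φ X = Φ (Q * X * Qᵀ) * ρ Q := by
  rw [h.map_conj Q hQ X hX, mul_assoc, ← hρ.map_mul _ (SOn_transpose_mem hQ) _ hQ, hQ.1,
    hρ.map_one, mul_one]

/-- An irreducible continuous representation of `SO_n` yields a rotation system. -/
theorem IsDifferential.isRotationSystem [NeZero d] (h : IsDifferential ρ Φ)
    (hρ : IsContinuousRep n d ρ) (hn : 3 ≤ n)
    (hirr : ∀ U : Submodule ℝ (Fin d → ℝ),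
      (∀ Q ∈ SOn n, ∀ v ∈ U, (ρ Q).mulVec v ∈ U) → U = ⊥ ∨ U = ⊤) :
    IsRotationSystem (fun k l => toLinAlgEquiv' (Φ (rotGen k l)))
      (fun i j => toLinAlgEquiv' (ρ (signFlip i * signFlip j))) where
  swap i j := by rw [rotGen_swap, map_neg, map_neg]
  lie i j k hij hjk hik := by
    rw [← map_mul toLinAlgEquiv', ← map_mul toLinAlgEquiv', ← map_sub,
      ← h.map_lie (rotGen_skew i j) (rotGen_skew j k),
      rotGen_lie hij hjk hik]
  comm i j k l hik hil hjk hjl := by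
    rw [← sub_eq_zero, ← map_mul toLinAlgEquiv', ← map_mul toLinAlgEquiv', ← map_sub,
      ← h.map_lie (rotGen_skew i j) (rotGen_skew k l), rotGen_comm hik hil hjk hjl, map_zero,
      map_zero]
  sign_self i := by rw [signFlip_mul_self, hρ.map_one, map_one]
  sign_symm i j := by rw [signFlip_comm]
  sign_mul i j k := by
    rw [← map_mul, ← hρ.map_mul _ (signFlip_mul_mem i j) _ (signFlip_mul_mem j k), mul_assoc,
      ← mul_assoc (signFlip j), signFlip_mul_self, one_mul]
  sign_comm i j k l := by
    refine (Commute.map (show _ = _ from ?_) (toLinAlgEquiv' (R := ℝ) (n := Fin d)))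
    rw [← hρ.map_mul _ (signFlip_mul_mem i j) _ (signFlip_mul_mem k l),
      ← hρ.map_mul _ (signFlip_mul_mem k l) _ (signFlip_mul_mem i j)]
    congr 1
    simp only [signFlip, diagonal_mul_diagonal]
    congr 1
    funext a
    ring
  sign_rot i j k l := by
    rw [← map_mul, ← map_mul, ← map_smul, h.rot_mul hρ (signFlip_mul_mem i j) (rotGen_skew k l),
      conj_rotGen (σ := id) (signFlip_mul_mulVec_single i j), map_smul, smul_mul_assoc]
    congr 2
    simp only [Pi.mul_apply]
    ring
  exists_swap i j hij := by
    obtain ⟨Q, hQ, c, hc, hQc⟩ := exists_signed_swap hij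
    have hQt := SOn_transpose_mem hQ
    refine ⟨LinearEquiv.ofLinearMap (toLinAlgEquiv' (ρ Q)) (toLinAlgEquiv' (ρ Qᵀ)) ?_ ?_,
      fun k l v => ?_, fun k l v hv => ?_⟩
    · rw [← Module.End.mul_eq_comp, ← map_mul, ← hρ.map_mul _ hQ _ hQt, SOn_mul_transpose hQ,
        hρ.map_one, map_one]
      rfl
    · rw [← Module.End.mul_eq_comp, ← map_mul, ← hρ.map_mul _ hQt _ hQ, hQ.1, hρ.map_one, map_one]
      rfl
    · simp only [LinearEquiv.coe_ofLinearMap, toLinAlgEquiv'_apply, mulVec_mulVec]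
      rw [← hρ.map_mul _ hQ _ (signFlip_mul_mem k l), ← hρ.map_mul _ (signFlip_mul_mem _ _) _ hQ,
        ← conj_signFlip hQc hc (SOn_mul_transpose hQ),
        ← conj_signFlip hQc hc (SOn_mul_transpose hQ)]
      simp only [mul_assoc, hQ.1, mul_one]
      rw [← mul_assoc Qᵀ, hQ.1, one_mul]
    · simp only [LinearEquiv.coe_ofLinearMap, toLinAlgEquiv'_apply, mulVec_mulVec] at hv ⊢
      have h1 := h.rot_mul hρ hQ (rotGen_skew k l)
      rw [conj_rotGen hQc, map_smul, smul_mul_assoc] at h1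
      have h2 : (c k * c l) • (Φ (rotGen (Equiv.swap i j k) (Equiv.swap i j l)) * ρ Q) *ᵥ v
          = 0 := by
        rw [← smul_mulVec, ← h1, ← mulVec_mulVec, hv, mulVec_zero]
      refine (smul_eq_zero.1 h2).resolve_left (mul_ne_zero ?_ ?_)
      · exact left_ne_zero_of_mul_eq_one (hc k)
      · exact left_ne_zero_of_mul_eq_one (hc l)
  irreducible U hU := by
    refine hirr U (h.mulVec_mem hρ hn fun X hX => ?_)
    refine skew_induction (P := fun X => ∀ v ∈ U, Φ X *ᵥ v ∈ U) (fun v _ => ?_)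
      (fun X Y h1 h2 v hv => ?_) (fun a X h1 v hv => ?_) (fun k l _ v hv => ?_) hX
    · rw [map_zero, zero_mulVec]; exact U.zero_mem
    · rw [map_add, add_mulVec]; exact U.add_mem (h1 v hv) (h2 v hv)
    · rw [map_smul, smul_mulVec]; exact U.smul_mem _ (h1 v hv)
    · exact hU k l v hv
  sign_fixed v hv i j := by
    refine h.mulVec_eq_self hρ hn (fun X hX => ?_) _ (signFlip_mul_mem i j)
    refine skew_induction (P := fun X => Φ X *ᵥ v = 0) ?_
      (fun X Y h1 h2 => ?_) (fun a X h1 => ?_) (fun k l _ => ?_) hX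
    · rw [map_zero, zero_mulVec]
    · rw [map_add, add_mulVec, h1, h2, add_zero]
    · rw [map_smul, smul_mulVec, h1, smul_zero]
    · exact hv k l

end RotationSystem

section Classification

open Matrix

variable {n d : ℕ} {ρ : Matrix (Fin n) (Fin n) ℝ → Matrix (Fin d) (Fin d) ℝ}
  {Φ : Matrix (Fin n) (Fin n) ℝ →ₗ[ℝ] Matrix (Fin d) (Fin d) ℝ}

/-- A nonzero injective equivariant map into an irreducible representation is an isomorphism. -/
theorem exists_equiv_of_equivariant
    (hirr : ∀ U : Submodule ℝ (Fin d → ℝ),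
      (∀ Q ∈ SOn n, ∀ v ∈ U, (ρ Q).mulVec v ∈ U) → U = ⊥ ∨ U = ⊤)
    {W : Type*} [AddCommGroup W] [Module ℝ W] (T : W →ₗ[ℝ] (Fin d → ℝ))
    (act : Matrix (Fin n) (Fin n) ℝ → W → W) (hT : ∀ Q ∈ SOn n, ∀ w, T (act Q w) = ρ Q *ᵥ T w)
    (hinj : ∀ w, T w = 0 → w = 0) (hne : T ≠ 0) :
    ∃ e : (Fin d → ℝ) ≃ₗ[ℝ] W, ∀ Q ∈ SOn n, ∀ v, e (ρ Q *ᵥ v) = act Q (e v) := by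
  have hsurj : T.range = ⊤ := by
    refine (hirr T.range ?_).resolve_left fun h => hne (LinearMap.range_eq_bot.1 h)
    rintro Q hQ _ ⟨w, rfl⟩
    exact ⟨act Q w, hT Q hQ w⟩
  let E := LinearEquiv.ofBijective T
    ⟨(injective_iff_map_eq_zero T).2 hinj, LinearMap.range_eq_top.1 hsurj⟩
  refine ⟨E.symm, fun Q hQ v => ?_⟩
  rw [LinearEquiv.symm_apply_eq]
  change _ = T _
  rw [hT Q hQ]
  exact congrArg (ρ Q *ᵥ ·) (E.apply_symm_apply v).symm

theorem IsDifferential.isoTrivial [NeZero d] (h : IsDifferential ρ Φ)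
    (hρ : IsContinuousRep n d ρ) (hn : 3 ≤ n)
    (hirr : ∀ U : Submodule ℝ (Fin d → ℝ),
      (∀ Q ∈ SOn n, ∀ v ∈ U, (ρ Q).mulVec v ∈ U) → U = ⊥ ∨ U = ⊤)
    {v : Fin d → ℝ} (hv0 : v ≠ 0) (hv : ∀ k l, k ≠ l → Φ (rotGen k l) *ᵥ v = 0) :
    IsoTrivial n d ρ := by
  have hfix := h.mulVec_eq_self hρ hn (v := v) fun X hX => by
    refine skew_induction (P := fun X => Φ X *ᵥ v = 0) ?_
      (fun X Y h1 h2 => ?_) (fun a X h1 => ?_) hv hX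
    · rw [map_zero, zero_mulVec]
    · rw [map_add, add_mulVec, h1, h2, add_zero]
    · rw [map_smul, smul_mulVec, h1, smul_zero]
  refine exists_equiv_of_equivariant hirr (LinearMap.toSpanSingleton ℝ _ v) (fun _ t => t)
    (fun Q hQ t => ?_) (fun t ht => ?_) fun h0 => hv0 ?_
  · rw [LinearMap.toSpanSingleton_apply, mulVec_smul, hfix Q hQ]
  · exact (smul_eq_zero.1 ht).resolve_right hv0
  · simpa using LinearMap.congr_fun h0 1

theorem IsDifferential.isoStandard [NeZero d] (h : IsDifferential ρ Φ)
    (hρ : IsContinuousRep n d ρ) (hn : 3 ≤ n)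
    (hirr : ∀ U : Submodule ℝ (Fin d → ℝ),
      (∀ Q ∈ SOn n, ∀ v ∈ U, (ρ Q).mulVec v ∈ U) → U = ⊥ ∨ U = ⊤)
    {y : Fin n → Fin d → ℝ} (hy0 : ∀ i, y i ≠ 0)
    (hy : ∀ k l i, k ≠ l → Φ (rotGen k l) *ᵥ y i
      = (if l = i then y k else 0) - (if k = i then y l else 0)) : IsoStandard n d ρ := by
  let T := Fintype.linearCombination ℝ y
  have hTsingle : ∀ i, T (Pi.single i 1) = y i := fun i => by
    simp [T, Fintype.linearCombination_apply_single]
  have hgen : ∀ k l, k ≠ l → ∀ v, T (rotGen k l *ᵥ v) = Φ (rotGen k l) *ᵥ T v := by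
    intro k l hkl v
    have hext : T ∘ₗ (rotGen k l).mulVecLin = (Φ (rotGen k l)).mulVecLin ∘ₗ T := by
      refine (Pi.basisFun ℝ (Fin n)).ext fun i => ?_
      simp only [Pi.basisFun_apply, LinearMap.comp_apply, mulVecLin_apply, hTsingle,
        hy k l i hkl, rotGen_mulVec_single, map_sub]
      split_ifs <;> simp only [hTsingle, map_zero]
    exact LinearMap.congr_fun hext v
  have hskew : ∀ X, Xᵀ = -X → ∀ v, T (X *ᵥ v) = Φ X *ᵥ T v := fun X hX => by
    refine skew_induction (P := fun X => ∀ v, T (X *ᵥ v) = Φ X *ᵥ T v) (fun v => ?_)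
      (fun X Y h1 h2 v => ?_) (fun a X h1 v => ?_) hgen hX
    · rw [zero_mulVec, map_zero, map_zero, zero_mulVec]
    · rw [add_mulVec, map_add, map_add, add_mulVec, h1, h2]
    · rw [smul_mulVec, map_smul, map_smul, smul_mulVec, h1]
  refine exists_equiv_of_equivariant hirr T (fun Q v => Q *ᵥ v)
    (h.equivariant_standard hρ hn T hskew) (fun v hv => funext fun i => ?_) fun h0 =>
      hy0 ⟨0, by omega⟩ (by rw [← hTsingle, h0, LinearMap.zero_apply])
  obtain ⟨k, hk⟩ := exists_fin_notMem (F := {i}) (by simp; omega)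
  obtain ⟨l, hl⟩ := exists_fin_notMem (F := {i, k}) (Finset.card_le_two.trans_lt (by omega))
  simp only [Finset.mem_insert, Finset.mem_singleton, not_or] at hk hl
  have hsum : ∑ j, v j • y j = 0 := hv
  have h1 : v i • y k - v k • y i = 0 := by
    have := congrArg (Φ (rotGen k i)).mulVecLin hsum
    simpa only [map_sum, map_smul, mulVecLin_apply, hy k i _ hk, smul_sub, smul_ite, smul_zero,
      Finset.sum_sub_distrib, Finset.sum_ite_eq, Finset.mem_univ, if_true, mulVec_zero] using this
  have h2 := congrArg (Φ (rotGen l k)).mulVecLin h1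
  simp only [map_sub, map_smul, mulVecLin_apply, hy l k _ hl.2, if_true, hl.1, hl.2, hk, if_false,
    sub_zero, smul_zero, mulVec_zero] at h2
  exact (smul_eq_zero.1 h2).resolve_right (hy0 l)

theorem IsDifferential.isoAlt [NeZero d] (h : IsDifferential ρ Φ)
    (hρ : IsContinuousRep n d ρ) (hn : 6 ≤ n)
    (hirr : ∀ U : Submodule ℝ (Fin d → ℝ),
      (∀ Q ∈ SOn n, ∀ v ∈ U, (ρ Q).mulVec v ∈ U) → U = ⊥ ∨ U = ⊤)
    {x : Fin n → Fin n → Fin d → ℝ}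
    (hx : IsTensorFamily (fun k l => toLinAlgEquiv' (Φ (rotGen k l))) (-1) x) :
    IsoAlt n d ρ := by
  have hsys := h.isRotationSystem hρ (by omega) hirr
  let T : Matrix (Fin n) (Fin n) ℝ →ₗ[ℝ] (Fin d → ℝ) :=
    { toFun := fun M => ∑ i, ∑ j, M i j • x i j
      map_add' := fun M N => by simp only [Matrix.add_apply, add_smul, Finset.sum_add_distrib]
      map_smul' := fun c M => by
        simp only [Matrix.smul_apply, smul_assoc, Finset.smul_sum, RingHom.id_apply] }
  have hTsingle : ∀ i j, T (single i j 1) = x i j := fun i j => by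
    change ∑ a, ∑ b, single i j (1 : ℝ) a b • x a b = x i j
    rw [Finset.sum_eq_single i, Finset.sum_eq_single j]
    · rw [single_apply_same, one_smul]
    · intro b _ hb
      rw [single_apply_of_ne _ _ _ _ _ (by tauto), zero_smul]
    · simp
    · intro a _ ha
      refine Finset.sum_eq_zero fun b _ => ?_
      rw [single_apply_of_ne _ _ _ _ _ (by tauto), zero_smul]
    · simp
  have hgen : ∀ k l, k ≠ l → ∀ M, T (rotGen k l * M - M * rotGen k l)
      = Φ (rotGen k l) *ᵥ T M := by
    intro k l hkl M
    have hext : T ∘ₗ (LinearMap.mulLeft ℝ (rotGen k l) - LinearMap.mulRight ℝ (rotGen k l))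
        = (Φ (rotGen k l)).mulVecLin ∘ₗ T := by
      refine (Matrix.stdBasis ℝ (Fin n) (Fin n)).ext fun ⟨i, j⟩ => ?_
      have h1 := hx.rot_apply hsys (by omega) i j hkl
      rw [toLinAlgEquiv'_apply] at h1
      rw [stdBasis_eq_single, LinearMap.comp_apply, LinearMap.sub_apply,
        LinearMap.mulLeft_apply, LinearMap.mulRight_apply, LinearMap.comp_apply,
        mulVecLin_apply, hTsingle, h1, rotGen_lie_single]
      simp only [map_sub, map_add, apply_ite T, hTsingle, map_zero]
    exact LinearMap.congr_fun hext M
  have hskew : ∀ X, Xᵀ = -X → ∀ M, Mᵀ = -M → T (X * M - M * X) = Φ X *ᵥ T M := fun X hX M _ => by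
    refine skew_induction (P := fun X => T (X * M - M * X) = Φ X *ᵥ T M) ?_
      (fun X Y h1 h2 => ?_) (fun a X h1 => ?_) (fun k l hkl => hgen k l hkl M) hX
    · rw [zero_mul, mul_zero, sub_zero, map_zero, map_zero, zero_mulVec]
    · rw [map_add, add_mulVec, ← h1, ← h2, ← map_add, add_mul, mul_add]
      congr 1
      abel
    · rw [map_smul, smul_mulVec, ← h1, ← map_smul, smul_sub, smul_mul_assoc, mul_smul_comm]
  have hrot := h.equivariant_conj hρ (by omega) T hskew
  have hinj : ∀ M, (T ∘ₗ (altTwo n).subtype) M = 0 → M = 0 := fun M hM => by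
    ext p q
    exact hx.coeff_eq_zero hsys hn (M := M.1)
      (fun i j => by simpa using congrFun (congrFun M.2 j) i) hM p q
  have hne : T ∘ₗ (altTwo n).subtype ≠ 0 := fun h0 => by
    let i : Fin n := ⟨0, by omega⟩
    let j : Fin n := ⟨1, by omega⟩
    have hij : i ≠ j := by simp [i, j]
    have h1 : T (rotGen i j) = 0 := LinearMap.congr_fun h0 ⟨rotGen i j, rotGen_skew i j⟩
    rw [rotGen, map_sub, hTsingle, hTsingle, hx.symm j i, neg_one_smul, sub_neg_eq_add,
      ← two_smul ℝ] at h1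
    exact hx.ne_zero i j hij ((smul_eq_zero.1 h1).resolve_left two_ne_zero)
  obtain ⟨e, he⟩ := exists_equiv_of_equivariant hirr (T ∘ₗ (altTwo n).subtype)
    (fun Q M => ⟨Q * M * Qᵀ, skew_conj M.2 Q⟩) (fun Q hQ M => hrot Q hQ M M.2) hinj hne
  exact ⟨e, fun Q hQ v => congrArg Subtype.val (he Q hQ v)⟩

theorem IsRotationSystem.hasPairLines {V : Type*} [AddCommGroup V] [Module ℝ V]
    [FiniteDimensional ℝ V] {A δ : Fin n → Fin n → Module.End ℝ V} (h : IsRotationSystem A δ)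
    (hn : 8 ≤ n) (hd : 2 * Module.finrank ℝ V < (n - 1) * (n + 2)) : HasPairLines δ where
  vanish i j k l hij hik hil hjk hjl hkl := by
    have h1 := h.signSpace_eq_bot hn hd (S := {i, j, k, l})
      (by simp [Finset.card_insert_of_notMem, *]) (by simp [Finset.card_insert_of_notMem, *])
    rwa [setSign_insert (by simp [*]), setSign_insert (by simp [*]), setSign_pair hkl,
      ← mul_assoc, ← mul_assoc] at h1
  line i j hij v hv w hw hv0 := by
    rw [← setSign_pair hij] at hv hw
    have h1 := (h.finrank_signSpace_pair hn hd (Finset.card_pair hij)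
      (Submodule.ne_bot_iff _ |>.2 ⟨v, hv, hv0⟩)).1
    obtain ⟨c, hc⟩ := (finrank_eq_one_iff_of_nonzero' (⟨v, hv⟩ : signSpace δ (setSign {i, j}))
      fun h0 => hv0 (congrArg Subtype.val h0)).1 h1 ⟨w, hw⟩
    exact ⟨c, (congrArg Subtype.val hc).symm⟩

theorem IsDifferential.iso_cases [NeZero d] (h : IsDifferential ρ Φ)
    (hρ : IsContinuousRep n d ρ) (hn : 8 ≤ n) (hd : 2 * d < (n - 1) * (n + 2))
    (hirr : ∀ U : Submodule ℝ (Fin d → ℝ),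
      (∀ Q ∈ SOn n, ∀ v ∈ U, (ρ Q).mulVec v ∈ U) → U = ⊥ ∨ U = ⊤) :
    IsoTrivial n d ρ ∨ IsoStandard n d ρ ∨ IsoAlt n d ρ := by
  have hsys := h.isRotationSystem hρ (by omega) hirr
  have : NeZero n := ⟨by omega⟩
  have hfin : 2 * Module.finrank ℝ (Fin d → ℝ) < (n - 1) * (n + 2) := by simpa using hd
  by_cases hone : ∃ i, signSpace (fun i j => toLinAlgEquiv' (ρ (signFlip i * signFlip j)))
      (flipSign i) ≠ ⊥
  · obtain ⟨b, hb⟩ := hone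
    refine Or.inr (Or.inl ?_)
    obtain ⟨y, hy0, hy⟩ := hsys.exists_standard_family (by omega) (fun i k l hik hil hkl => by
      have h1 := hsys.signSpace_eq_bot hn hfin (S := {i, k, l})
        (by simp [Finset.card_insert_of_notMem, *])
        (by simp [Finset.card_insert_of_notMem, *]; omega)
      rwa [setSign_insert (by simp [*]), setSign_pair hkl, ← mul_assoc] at h1) hb
    exact h.isoStandard hρ (by omega) hirr hy0 hy
  by_cases htwo : ∃ i j, i ≠ j ∧ signSpace
      (fun i j => toLinAlgEquiv' (ρ (signFlip i * signFlip j))) (flipSign i * flipSign j) ≠ ⊥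
  · obtain ⟨b, a, hab, hne⟩ := htwo
    refine Or.inr (Or.inr ?_)
    have h1 := (hsys.finrank_signSpace_pair hn hfin (Finset.card_pair hab)
      (by rwa [setSign_pair hab])).2
    obtain ⟨x, hx⟩ := (hsys.hasPairLines hn hfin).exists_isTensorFamily hsys (by omega) hab hne h1
    exact h.isoAlt hρ (by omega) hirr hx
  push Not at hone htwo
  refine Or.inl ?_
  obtain ⟨S, hS, hne⟩ := hsys.exists_signSpace_ne_bot
  have hcard : S.card = 0 := by
    by_contra h0
    by_cases h1 : S.card = 1
    · obtain ⟨i, rfl⟩ := Finset.card_eq_one.1 h1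
      exact hne (by rw [setSign_singleton]; exact hone i)
    by_cases h2 : S.card = 2
    · obtain ⟨i, j, hij, rfl⟩ := Finset.card_eq_two.1 h2
      exact hne (by rw [setSign_pair hij]; exact htwo i j hij)
    exact hne (hsys.signSpace_eq_bot hn hfin (by omega) (by omega))
  rw [Finset.card_eq_zero.1 hcard, setSign_empty] at hne
  obtain ⟨v, hv, hv0⟩ := Submodule.exists_mem_ne_zero_of_ne_bot hne
  refine h.isoTrivial hρ (by omega) hirr hv0 fun k l hkl => ?_
  have h1 := hsys.rot_mem hv k l
  rw [mul_one, htwo k l hkl] at h1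
  exact (Submodule.mem_bot ℝ).1 h1

theorem not_isoTrivial_and_isoStandard (hn : 2 ≤ n) (h1 : IsoTrivial n d ρ)
    (h2 : IsoStandard n d ρ) : False := by
  obtain ⟨e₁, -⟩ := h1
  obtain ⟨e₂, -⟩ := h2
  have h := (e₁.symm.trans e₂).finrank_eq
  simp at h
  omega

theorem rotGen_ne_zero {i j : Fin n} (hij : i ≠ j) : rotGen i j ≠ 0 := fun h0 => by
  have := congrFun (congrFun h0 i) j
  simp [rotGen, hij] at this

theorem IsoAlt.exists_sign_vector {i j : Fin n} (hij : i ≠ j) (h : IsoAlt n d ρ) :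
    ∃ v ≠ 0, ∀ k l, ρ (signFlip k * signFlip l) *ᵥ v
      = ((flipSign i k * flipSign i l) * (flipSign j k * flipSign j l)) • v := by
  obtain ⟨e, he⟩ := h
  refine ⟨e.symm ⟨rotGen i j, rotGen_skew i j⟩, fun h0 => ?_, fun k l => ?_⟩
  · rw [LinearEquiv.symm_apply_eq, map_zero] at h0
    exact rotGen_ne_zero hij (congrArg Subtype.val h0)
  · refine e.injective (Subtype.ext ?_)
    rw [he _ (signFlip_mul_mem k l), map_smul, e.apply_symm_apply, Submodule.coe_smul]
    exact conj_rotGen (σ := id) (signFlip_mul_mulVec_single k l) i j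

theorem not_isoTrivial_and_isoAlt (hn : 3 ≤ n) (h1 : IsoTrivial n d ρ)
    (h2 : IsoAlt n d ρ) : False := by
  let i : Fin n := ⟨0, by omega⟩
  let j : Fin n := ⟨1, by omega⟩
  let k : Fin n := ⟨2, by omega⟩
  obtain ⟨e, he⟩ := h1
  obtain ⟨v, hv0, hv⟩ := h2.exists_sign_vector (i := i) (j := j) (by simp [i, j])
  have h := he _ (signFlip_mul_mem i k) v
  rw [hv] at h
  have h3 : (-1 : ℝ) • v = v := by
    have := e.injective h
    simpa [i, j, k, flipSign] using this
  rw [neg_one_smul] at h3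
  exact hv0 (self_eq_neg.1 h3.symm)

theorem not_isoStandard_and_isoAlt (hn : 4 ≤ n) (h1 : IsoStandard n d ρ)
    (h2 : IsoAlt n d ρ) : False := by
  let i : Fin n := ⟨0, by omega⟩
  let j : Fin n := ⟨1, by omega⟩
  have hij : i ≠ j := by simp [i, j]
  obtain ⟨e, he⟩ := h1
  obtain ⟨v, hv0, hv⟩ := h2.exists_sign_vector hij
  have hcoord : ∀ k l a, flipSign k a * (flipSign l a * e v a)
      = ((flipSign i k * flipSign i l) * (flipSign j k * flipSign j l)) * e v a := fun k l a => by
    have h := congrFun (he _ (signFlip_mul_mem k l) v) a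
    rw [hv, map_smul, ← mulVec_mulVec, signFlip, mulVec_diagonal, signFlip, mulVec_diagonal] at h
    exact h.symm
  refine hv0 (e.map_eq_zero_iff.1 (funext fun a => ?_))
  by_cases ha : a = i
  · obtain ⟨m, hm⟩ := exists_fin_notMem (F := {i, j}) (Finset.card_le_two.trans_lt (by omega))
    simp only [Finset.mem_insert, Finset.mem_singleton, not_or] at hm
    have h := hcoord j m a
    rw [ha, flipSign_of_ne hij, flipSign_of_ne (Ne.symm hm.1), flipSign_of_ne hij.symm,
      flipSign_of_ne hm.1, flipSign_of_ne hm.2, flipSign_self] at h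
    rw [ha, Pi.zero_apply]
    linarith
  · obtain ⟨m, hm⟩ := exists_fin_notMem (F := {i, j, a})
      (Finset.card_le_three.trans_lt (by omega))
    simp only [Finset.mem_insert, Finset.mem_singleton, not_or] at hm
    have h := hcoord i m a
    rw [flipSign_of_ne ha, flipSign_of_ne (Ne.symm hm.2.2), flipSign_of_ne hij,
      flipSign_of_ne hm.1, flipSign_of_ne hm.2.1, flipSign_self] at h
    rw [Pi.zero_apply]
    linarith

end Classification

/-- Let `n ≥ 17`.  Every irreducible finite-dimensional continuous real
representation of `SO_n(ℝ)` (realized on `ℝᵈ`, `d > 0`, with only invariant subspaces `⊥` and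
`⊤`) whose dimension satisfies `d < (n−1)(n+2)/2` (i.e. `2d < (n−1)(n+2)`) is isomorphic to
exactly one of: the trivial representation `ℝ`, the standard representation `ℝⁿ`, or
`Alt²(ℝⁿ)` with the conjugation action (of dimensions `1`, `n`, `n(n−1)/2` respectively). -/
theorem irreducible_low_dim_classification
    (n : ℕ) (hn : 17 ≤ n)
    (d : ℕ) (hd0 : 0 < d) (hd : 2 * d < (n - 1) * (n + 2))
    (ρ : Matrix (Fin n) (Fin n) ℝ → Matrix (Fin d) (Fin d) ℝ)
    (hρ1 : ρ 1 = 1)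
    (hρmul : ∀ Q ∈ SOn n, ∀ R ∈ SOn n, ρ (Q * R) = ρ Q * ρ R)
    (hρunit : ∀ Q ∈ SOn n, IsUnit (ρ Q))
    (hρcont : ContinuousOn ρ (SOn n))
    (hirr : ∀ U : Submodule ℝ (Fin d → ℝ),
      (∀ Q ∈ SOn n, ∀ v ∈ U, (ρ Q).mulVec v ∈ U) → U = ⊥ ∨ U = ⊤) :
    ∃! k : Fin 3,
      (if k = 0 then IsoTrivial n d ρ else if k = 1 then IsoStandard n d ρ
        else IsoAlt n d ρ) := by
  have : NeZero d := ⟨hd0.ne'⟩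
  have : NeZero n := ⟨by omega⟩
  have hρ : IsContinuousRep n d ρ := ⟨hρ1, hρmul, hρcont⟩
  obtain ⟨Φ, hexp, hconj⟩ := hρ.exists_differential
  have h12 := not_isoTrivial_and_isoStandard (n := n) (d := d) (ρ := ρ) (by omega)
  have h13 := not_isoTrivial_and_isoAlt (n := n) (d := d) (ρ := ρ) (by omega)
  have h23 := not_isoStandard_and_isoAlt (n := n) (d := d) (ρ := ρ) (by omega)
  rcases IsDifferential.iso_cases ⟨hexp, hconj⟩ hρ (by omega) hd hirr with h | h | h
  · refine ⟨0, by simpa using h, fun k hk => ?_⟩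
    fin_cases k
    · rfl
    · exact (h12 h (by simpa using hk)).elim
    · exact (h13 h (by simpa using hk)).elim
  · refine ⟨1, by simpa using h, fun k hk => ?_⟩
    fin_cases k
    · exact (h12 (by simpa using hk) h).elim
    · rfl
    · exact (h23 h (by simpa using hk)).elim
  · refine ⟨2, by simpa using h, fun k hk => ?_⟩
    fin_cases k
    · exact (h13 (by simpa using hk) h).elim
    · exact (h23 (by simpa using hk) h).elim
    · rfl
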